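/- There exist absolute constants c > 0 and κ > 0 such that the following holds. Let P ∈ ℂ[x,y] be an irreducible polynomial of degree d > 0. Then for every real H ≥ 2, the number of points (x,y) ∈ ℤ² with P(x,y) = 0, |x| ≤ H and |y| ≤ H is at most c·d²·H^{1/d}·(log H)^κ. -/

import Mathlib

open MvPolynomial


abbrev BP (R : Type) [CommSemiring R] := MvPolynomial (Fin 2) R
noncomputable abbrev PD (k : ℕ) := restrictTotalDegree (Fin 2) ℂ k

lemma finrank_PD (k : ℕ) : 2 * Module.finrank ℂ (PD k) = (k+1)*(k+2) := by
  have h1 : Module.finrank ℂ (PD k) = Nat.card {n : Fin 2 →₀ ℕ | (n.sum fun _ e => e) ≤ k} :=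
    Module.finrank_eq_nat_card_basis (basisRestrictSupport ℂ _)
  rw [h1]
  have e : {n : Fin 2 →₀ ℕ | (n.sum fun _ e => e) ≤ k} ≃
      ((Finset.range (k+1)).sigma (fun i => Finset.HasAntidiagonal.antidiagonal i)) := by
    refine Equiv.ofBijective (fun n => ⟨⟨n.1 0 + n.1 1, (n.1 0, n.1 1)⟩, ?_⟩) ⟨?_, ?_⟩
    · have := n.2
      simp [Finsupp.sum_fintype] at this ⊢
      omega
    · rintro ⟨a, ha⟩ ⟨b, hb⟩ h
      simp at h
      ext i
      fin_cases i
      · exact h.2.1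
      · exact h.2.2
    · rintro ⟨⟨i, a, b⟩, h⟩
      simp at h
      refine ⟨⟨Finsupp.equivFunOnFinite.symm ![a, b], ?_⟩, ?_⟩
      · simp [Finsupp.sum_fintype]
        omega
      · ext <;> simp [h.2]
  rw [Nat.card_congr e, Nat.card_eq_fintype_card, Fintype.card_coe, Finset.card_sigma]
  simp only [Finset.Nat.card_antidiagonal]
  clear h1 e
  induction k with
  | zero => simp
  | succ k ih =>
    rw [Finset.sum_range_succ, mul_add, ih]
    ring

/-- multiplication by a fixed polynomial on the filtered pieces -/
noncomputable def mulPD (f : BP ℂ) (a b : ℕ) (h : f.totalDegree + a ≤ b) : PD a →ₗ[ℂ] PD b :=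
  (LinearMap.mulLeft ℂ f).restrict (fun x hx => by
    rw [mem_restrictTotalDegree] at hx ⊢
    exact (totalDegree_mul _ _).trans (by omega))

lemma mulPD_apply (f : BP ℂ) (a b : ℕ) (h : f.totalDegree + a ≤ b) (x : PD a) :
    (mulPD f a b h x : BP ℂ) = f * x := rfl

lemma exists_interp (Z : Finset (Fin 2 → ℂ)) (z : Fin 2 → ℂ) :
    ∃ q : BP ℂ, q.totalDegree ≤ Z.card ∧ eval z q ≠ 0 ∧ ∀ w ∈ Z, w ≠ z → eval w q = 0 := by
  classical
  have key : ∀ w : Fin 2 → ℂ, ∃ l : BP ℂ, l.totalDegree ≤ 1 ∧ eval z l ≠ 0 ∧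
      (w ≠ z → eval w l = 0) := by
    intro w
    by_cases h : w = z
    · exact ⟨1, by simp, by simp, fun h' => absurd h h'⟩
    · obtain ⟨i, hi⟩ := Function.ne_iff.mp h
      refine ⟨X i - C (w i), (totalDegree_sub_C_le _ _).trans (by simp), ?_, ?_⟩
      · simp [sub_eq_zero]; exact fun h => hi h.symm
      · intro _; simp
  choose l h1 h2 h3 using key
  refine ⟨∏ w ∈ Z, l w, ?_, ?_, ?_⟩
  · refine (totalDegree_finsetProd _ _).trans ?_
    refine (Finset.sum_le_sum (fun w _ => h1 w)).trans (by simp)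
  · rw [map_prod, Finset.prod_ne_zero_iff]; exact fun w _ => h2 w
  · intro w hw hne
    rw [map_prod]
    exact Finset.prod_eq_zero hw (h3 w hne)

theorem bezout (f q : BP ℂ) (hf : Irreducible f) (hq : ¬ f ∣ q) (Z : Finset (Fin 2 → ℂ))
    (hZ : ∀ z ∈ Z, eval z f = 0 ∧ eval z q = 0) :
    Z.card ≤ f.totalDegree * q.totalDegree := by
  classical
  set d := f.totalDegree with hd
  set n := q.totalDegree with hn
  set m := Z.card with hm
  have hf0 : f ≠ 0 := hf.ne_zero
  have hq0 : q ≠ 0 := fun h => hq (h ▸ dvd_zero f)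
  let ev : PD (d + n + m) →ₗ[ℂ] (Z → ℂ) :=
    (LinearMap.pi (fun z : Z => (aeval z.1 : BP ℂ →ₐ[ℂ] ℂ).toLinearMap)).comp (Submodule.subtype _)
  have hev : ∀ x z, ev x z = eval z.1 (x : BP ℂ) := by
    intro x z
    simp [ev, aeval_eq_eval]
  have hsurj : Function.Surjective ev := by
    rw [← LinearMap.range_eq_top, ← top_le_iff, ← (Pi.basisFun ℂ Z).span_eq, Submodule.span_le]
    rintro _ ⟨z, rfl⟩
    obtain ⟨p, hp1, hp2, hp3⟩ := exists_interp Z z.1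
    have hpm : p ∈ PD (d + n + m) := by
      rw [mem_restrictTotalDegree]; omega
    refine ⟨(eval z.1 p)⁻¹ • ⟨p, hpm⟩, ?_⟩
    · ext w
      rw [map_smul, Pi.smul_apply, hev]
      by_cases h : w = z
      · subst h; simp [hp2]
      · simp [hp3 w.1 w.2 (fun h' => h (Subtype.ext h')), h]
  let Ψ : (PD (n + m) × PD (d + m)) →ₗ[ℂ] PD (d + n + m) :=
    (mulPD f (n+m) (d+n+m) (by omega)).coprod (mulPD q (d+m) (d+n+m) (by omega))
  have hΨ : ∀ a b, ((Ψ (a, b) : PD (d+n+m)) : BP ℂ) = f * a + q * b := by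
    intro a b
    simp [Ψ, mulPD_apply]
  let Θ : PD m →ₗ[ℂ] (PD (n + m) × PD (d + m)) :=
    (mulPD q m (n+m) (by omega)).prod (-(mulPD f m (d+m) (by omega)))
  have hker : LinearMap.ker Ψ ≤ LinearMap.range Θ := by
    rintro ⟨a, b⟩ hab
    have h1 : f * (a : BP ℂ) + q * b = 0 := by
      rw [← hΨ, LinearMap.mem_ker.mp hab]; rfl
    have h2 : f ∣ q * (b : BP ℂ) := ⟨-a, by linear_combination h1⟩
    have h3 : f ∣ (b : BP ℂ) := (hf.prime.dvd_or_dvd h2).resolve_left hq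
    obtain ⟨c, hc⟩ := h3
    have h4 : (a : BP ℂ) = - (q * c) := by
      apply mul_left_cancel₀ hf0
      rw [hc] at h1
      linear_combination h1
    have hcm : c.totalDegree ≤ m := by
      by_cases hc0 : c = 0
      · simp [hc0]
      · have := (mem_restrictTotalDegree (Fin 2) (d+m) (b : BP ℂ)).mp b.2
        rw [hc, totalDegree_mul_of_isDomain hf0 hc0] at this
        omega
    refine ⟨-⟨c, (mem_restrictTotalDegree _ _ _).mpr hcm⟩, ?_⟩
    ext1
    · apply Subtype.ext; simp [Θ, mulPD_apply, h4]
    · apply Subtype.ext; simp [Θ, mulPD_apply, hc]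
  have hr : LinearMap.range Ψ ≤ LinearMap.ker ev := by
    rintro _ ⟨⟨a, b⟩, rfl⟩
    rw [LinearMap.mem_ker]
    ext z
    rw [hev, hΨ]
    simp [hZ z.1 z.2]
  have e1 := LinearMap.finrank_range_add_finrank_ker Ψ
  have e2 := LinearMap.finrank_range_add_finrank_ker ev
  have e3 := Submodule.finrank_mono hker
  have e4 := Submodule.finrank_mono hr
  have e5 := LinearMap.finrank_range_le Θ
  rw [LinearMap.range_eq_top.mpr hsurj, finrank_top] at e2
  rw [Module.finrank_prod] at e1
  rw [Module.finrank_fintype_fun_eq_card, Fintype.card_coe] at e2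
  have t1 := finrank_PD m
  have t2 := finrank_PD (n+m)
  have t3 := finrank_PD (d+m)
  have t4 := finrank_PD (d+n+m)
  nlinarith


section Wronskian
variable {R : Type} [CommRing R] [IsDomain R] [Algebra ℂ R] (δ : Derivation ℂ R R)

lemma wr_ind (n : ℕ) : ∀ (φ : Fin n → R),
    (Matrix.of fun i j : Fin n => (δ^[(j : ℕ)]) (φ i)).det = 0 →
    ∃ r : Fin n → R, r ≠ 0 ∧ ∑ i, r i * φ i = 0 ∧ ∀ i k, δ (r i) * r k = r i * δ (r k) := by
  induction n with
  | zero => intro φ h; simp at h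
  | succ n ih =>
    intro φ h
    obtain ⟨r, hr0, hr⟩ := Matrix.exists_vecMul_eq_zero_iff.mpr h
    have hrel : ∀ j : ℕ, j < n + 1 → ∑ i, r i * (δ^[j]) (φ i) = 0 := by
      intro j hj
      have := congrFun hr ⟨j, hj⟩
      simpa [Matrix.vecMul, dotProduct] using this
    obtain ⟨k, hk⟩ := Function.ne_iff.mp hr0
    simp only [Pi.zero_apply] at hk
    have hrel' : ∀ j : ℕ, j < n → ∑ i, δ (r i) * (δ^[j]) (φ i) = 0 := by
      intro j hj
      have h1 := congrArg δ (hrel j (by omega))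
      have h2 := hrel (j+1) (by omega)
      simp only [map_sum, Derivation.leibniz, map_zero, smul_eq_mul, Finset.sum_add_distrib] at h1
      simp only [Function.iterate_succ', Function.comp] at h2
      rw [h2, zero_add] at h1
      rw [← h1]
      exact Finset.sum_congr rfl fun i _ => mul_comm _ _
    by_cases hs : ∀ i, r k * δ (r i) - δ (r k) * r i = 0
    · refine ⟨r, hr0, by simpa using hrel 0 (by omega), fun i l => ?_⟩
      apply mul_left_cancel₀ hk
      have h1 := hs i
      have h2 := hs l
      linear_combination r l * h1 - r i * h2
    · push Not at hs
      obtain ⟨i0, hi0⟩ := hs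
      have hdet : (Matrix.of fun i j : Fin n => (δ^[(j : ℕ)]) (φ (k.succAbove i))).det = 0 := by
        apply Matrix.exists_vecMul_eq_zero_iff.mp
        refine ⟨fun i => r k * δ (r (k.succAbove i)) - δ (r k) * r (k.succAbove i), ?_, ?_⟩
        · have : i0 ≠ k := by rintro rfl; apply hi0; ring
          obtain ⟨i1, rfl⟩ := Fin.exists_succAbove_eq this
          intro hh
          exact hi0 (congrFun hh i1)
        · ext j
          have h1 := hrel' j j.2
          have h2 := hrel j (by omega)
          rw [Fin.sum_univ_succAbove _ k] at h1 h2
          simp only [Matrix.vecMul, dotProduct, Matrix.of_apply, Pi.zero_apply, sub_mul,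
            Finset.sum_sub_distrib, mul_assoc, ← Finset.mul_sum]
          linear_combination r k * h1 - δ (r k) * h2
      obtain ⟨r', h0, h1, h2⟩ := ih _ hdet
      refine ⟨k.insertNth (α := fun _ => R) 0 r', ?_, ?_, ?_⟩
      · intro hh
        apply h0
        ext i
        have := congrFun hh (k.succAbove i)
        simpa using this
      · rw [Fin.sum_univ_succAbove _ k]
        simpa using h1
      · intro i l
        rcases Fin.eq_self_or_eq_succAbove k i with rfl | ⟨i, rfl⟩
        · simp
        · rcases Fin.eq_self_or_eq_succAbove k l with rfl | ⟨l, rfl⟩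
          · simp
          · simpa using h2 i l

lemma wr_lin (x s : R) (hs : s ≠ 0) (hx : δ x ≠ 0) (m : ℕ) (M : ℕ) : ∀ u : ℕ → R,
    (∀ j, s * δ (u j) = m * δ s * u j) → ∑ j ∈ Finset.range M, u j * x ^ j = 0 →
    ∀ j < M, u j = 0 := by
  induction M with
  | zero => intro u _ _ j hj; omega
  | succ M ih =>
    intro u hu hsum
    have key : ∑ j ∈ Finset.range M, (((j + 1 : ℕ) : R) * u (j+1)) * x ^ j = 0 := by
      have h1 : s * δ (∑ j ∈ Finset.range (M+1), u j * x ^ j) = 0 := by rw [hsum]; simp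
      have h2 : s * δ (∑ j ∈ Finset.range (M+1), u j * x ^ j)
          = m * δ s * (∑ j ∈ Finset.range (M+1), u j * x ^ j) +
            s * δ x * ∑ j ∈ Finset.range M, (((j + 1 : ℕ) : R) * u (j+1)) * x ^ j := by
        rw [map_sum, Finset.mul_sum, Finset.mul_sum, Finset.mul_sum]
        have h3 : ∀ j, s * δ (u j * x ^ j) = m * δ s * (u j * x ^ j) +
            s * δ x * ((j : R) * u j * x ^ (j-1)) := by
          intro j
          rw [Derivation.leibniz, Derivation.leibniz_pow]
          simp only [smul_eq_mul, nsmul_eq_mul]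
          linear_combination x ^ j * hu j
        simp_rw [h3]
        rw [Finset.sum_add_distrib, Finset.sum_range_succ' (fun j => s * δ x * _)]
        simp
      rw [h1, hsum, mul_zero, zero_add] at h2
      exact (mul_eq_zero.mp h2.symm).resolve_left (mul_ne_zero hs hx)
    have h4 := ih (fun j => ((j + 1 : ℕ) : R) * u (j+1)) (by
      intro j
      rw [Derivation.leibniz]
      simp only [smul_eq_mul, Derivation.map_natCast, mul_zero, add_zero]
      linear_combination ((j + 1 : ℕ) : R) * hu (j+1)) key
    have : CharZero R := 
      charZero_of_injective_algebraMap (algebraMap ℂ R).injective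
    have h5 : ∀ j < M, u (j+1) = 0 := by
      intro j hj
      exact (mul_eq_zero.mp (h4 j hj)).resolve_left (Nat.cast_ne_zero.mpr (by omega))
    intro j hj
    rcases j with _ | j
    · rw [Finset.sum_range_succ'] at hsum
      rw [Finset.sum_eq_zero (fun j hj => by rw [h5 j (Finset.mem_range.mp hj), zero_mul])] at hsum
      simpa using hsum
    · exact h5 j (by omega)

lemma wr_alg (r s : R) (hs : s ≠ 0) (m : ℕ) (c : Fin (m+1) → ℂ) (hc : c ≠ 0)
    (h : ∑ i, c i • (r ^ (i : ℕ) * s ^ (m - i)) = 0) : ∃ α : ℂ, r = α • s := by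
  let K := FractionRing R
  let ι : R →ₐ[ℂ] K := IsScalarTower.toAlgHom ℂ R K
  have hι : Function.Injective ι := IsFractionRing.injective R K
  have hs' : ι s ≠ 0 := fun h => hs (hι (by simpa using h))
  let q : Polynomial ℂ := ∑ i : Fin (m+1), Polynomial.monomial i (c i)
  have hq : q ≠ 0 := by
    intro h0
    apply hc
    ext i
    have := congrArg (fun p => Polynomial.coeff p i) h0
    simpa [q, Polynomial.finsetSum_coeff, Polynomial.coeff_monomial, Fin.val_inj] using this
  have hq2 : Polynomial.aeval (ι r / ι s) q = 0 := by
    have h1 : Polynomial.aeval (ι r / ι s) q * ι s ^ m = 0 := by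
      have h2 := congrArg ι h
      rw [map_zero, map_sum] at h2
      rw [← h2, map_sum, Finset.sum_mul]
      refine Finset.sum_congr rfl fun i _ => ?_
      rw [Polynomial.aeval_monomial, map_smul, map_mul, map_pow, map_pow, Algebra.smul_def]
      have : ι s ^ m = ι s ^ (i : ℕ) * ι s ^ (m - i) := by
        rw [← pow_add]; congr 1; omega
      rw [this, div_pow, mul_assoc, ← mul_assoc (_ / _), div_mul_cancel₀ _ (pow_ne_zero _ hs')]
    exact (mul_eq_zero.mp h1).resolve_right (pow_ne_zero _ hs')
  have h_integral : IsIntegral ℂ (ι r / ι s) := by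
    rw [← isAlgebraic_iff_isIntegral]
    exact ⟨q, hq, hq2⟩
  obtain ⟨α, hα⟩ : ∃ α : ℂ, algebraMap ℂ K α = ι r / ι s := by
    have hd := IsAlgClosed.degree_eq_one_of_irreducible ℂ (minpoly.irreducible h_integral)
    have := minpoly.mem_range_of_degree_eq_one ℂ (ι r / ι s) hd
    exact this
  refine ⟨α, hι ?_⟩
  rw [map_smul, Algebra.smul_def, hα, div_mul_cancel₀ _ hs']

lemma wr_const (x : R) (hx : δ x ≠ 0)
    (hdim : ∀ r s : R, ∃ m M : ℕ, ¬ LinearIndependent ℂ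
      (fun ij : Fin (m+1) × Fin (M+1) => r ^ (ij.1 : ℕ) * s ^ (m - ij.1) * x ^ (ij.2 : ℕ)))
    (r s : R) (hs : s ≠ 0) (h : δ r * s = r * δ s) : ∃ α : ℂ, r = α • s := by
  obtain ⟨m, M, hli⟩ := hdim r s
  rw [Fintype.not_linearIndependent_iff] at hli
  obtain ⟨c, hc, ⟨i0, j0⟩, hc0⟩ := hli
  have hri : ∀ i : ℕ, s * δ (r ^ i) = i * r ^ i * δ s := by
    intro i
    induction i with
    | zero => simp
    | succ i ih =>
      rw [pow_succ, Derivation.leibniz]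
      simp only [smul_eq_mul]; push_cast
      linear_combination r * ih + r ^ i * h
  have hsi : ∀ i : ℕ, s * δ (s ^ i) = i * s ^ i * δ s := by
    intro i
    induction i with
    | zero => simp
    | succ i ih =>
      rw [pow_succ, Derivation.leibniz]
      simp only [smul_eq_mul]; push_cast
      linear_combination s * ih
  let u : ℕ → R := fun j => if hj : j < M + 1 then
    ∑ i : Fin (m+1), c (i, ⟨j, hj⟩) • (r ^ (i : ℕ) * s ^ (m - i)) else 0
  have hu : ∀ j, s * δ (u j) = m * δ s * u j := by
    intro j
    by_cases hj : j < M + 1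
    · simp only [u, hj, dite_true, map_sum, Finset.mul_sum]
      refine Finset.sum_congr rfl fun i _ => ?_
      rw [Derivation.map_smul, Derivation.leibniz, mul_smul_comm, mul_smul_comm]
      congr 1
      simp only [smul_eq_mul]
      have h1 := hri i
      have h2 := hsi (m - i)
      have h3 : ((m - (i : ℕ) : ℕ) : R) = m - (i : ℕ) := by
        rw [Nat.cast_sub (by omega)]
      rw [h3] at h2
      linear_combination r ^ (i : ℕ) * h2 + s ^ (m - (i : ℕ)) * h1
    · simp only [u, hj, dite_false, map_zero, mul_zero]
  have hsum : ∑ j ∈ Finset.range (M+1), u j * x ^ j = 0 := by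
    rw [Finset.sum_range, ← hc, Fintype.sum_prod_type_right]
    refine Finset.sum_congr rfl fun j _ => ?_
    simp only [u, j.2, dite_true, Finset.sum_mul, smul_mul_assoc]
  have hz := wr_lin δ x s hs hx m (M+1) u hu hsum j0 j0.2
  simp only [u, j0.2, dite_true] at hz
  refine wr_alg r s hs m (fun i => c (i, j0)) ?_ hz
  intro hh
  exact hc0 (congrFun hh i0)

lemma wr_main (x : R) (hx : δ x ≠ 0)
    (hdim : ∀ r s : R, ∃ m M : ℕ, ¬ LinearIndependent ℂ
      (fun ij : Fin (m+1) × Fin (M+1) => r ^ (ij.1 : ℕ) * s ^ (m - ij.1) * x ^ (ij.2 : ℕ)))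
    (n : ℕ) (φ : Fin n → R) (hφ : LinearIndependent ℂ φ) :
    (Matrix.of fun i j : Fin n => (δ^[(j : ℕ)]) (φ i)).det ≠ 0 := by
  intro h
  obtain ⟨r, hr0, hr1, hr2⟩ := wr_ind δ n φ h
  obtain ⟨k, hk⟩ := Function.ne_iff.mp hr0
  simp only [Pi.zero_apply] at hk
  have := fun i => wr_const δ x hx hdim (r i) (r k) hk (hr2 i k)
  choose α hα using this
  have h1 : ∑ i, α i • φ i = 0 := by
    apply mul_left_cancel₀ hk
    rw [mul_zero, ← hr1, Finset.mul_sum]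
    refine Finset.sum_congr rfl fun i _ => ?_
    rw [hα i, smul_mul_assoc, mul_smul_comm]
  have h2 := Fintype.linearIndependent_iff.mp hφ α h1 k
  have h3 := hα k
  rw [h2, zero_smul] at h3
  exact hk h3
end Wronskian


/-- The tangential derivation of the curve `g = 0`. -/
noncomputable def dl {R : Type} [CommRing R] (g : BP R) : Derivation R (BP R) (BP R) :=
  pderiv 1 g • pderiv 0 - pderiv 0 g • pderiv 1

lemma dl_apply {R : Type} [CommRing R] (g q : BP R) :
    dl g q = pderiv 1 g * pderiv 0 q - pderiv 0 g * pderiv 1 q := by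
  simp [dl]

/-- The monomials used in the determinant method. -/
noncomputable def phi {R : Type} [CommRing R] (B i : ℕ) : BP R := X 0 ^ (i / B) * X 1 ^ (i % B)

noncomputable def Wr {R : Type} [CommRing R] (g : BP R) (B D : ℕ) : BP R :=
  (Matrix.of fun i j : Fin D => ((dl g)^[(j : ℕ)]) (phi B i)).det

section maps
variable {R S : Type} [CommRing R] [CommRing S] (ψ : R →+* S)

lemma map_dl (g q : BP R) : map ψ (dl g q) = dl (map ψ g) (map ψ q) := by
  simp [dl_apply, pderiv_map]

lemma map_dl_iter (g q : BP R) (j : ℕ) :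
    map ψ (((dl g)^[j]) q) = ((dl (map ψ g))^[j]) (map ψ q) := by
  induction j with
  | zero => rfl
  | succ j ih => rw [Function.iterate_succ_apply', Function.iterate_succ_apply', map_dl, ih]

lemma map_phi (B i : ℕ) : map ψ (phi B i : BP R) = phi B i := by simp [phi]

lemma map_Wr (g : BP R) (B D : ℕ) : map ψ (Wr g B D) = Wr (map ψ g) B D := by
  rw [Wr, Wr, RingHom.map_det]
  congr 1
  ext1 i j
  simp [map_dl_iter, map_phi]
end maps

lemma phi_eq {R : Type} [CommRing R] (B i : ℕ) : (phi B i : BP R) =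
    monomial (Finsupp.single 0 (i / B) + Finsupp.single 1 (i % B)) 1 := by
  rw [phi, X_pow_eq_monomial, X_pow_eq_monomial, monomial_mul, one_mul]

lemma phi_li (B D : ℕ) (hB : 0 < B) :
    LinearIndependent ℂ (fun i : Fin D => (phi B i : BP ℂ)) := by
  have := (basisMonomials (Fin 2) ℂ).linearIndependent.comp
    (fun i : Fin D => (Finsupp.single 0 ((i:ℕ) / B) + Finsupp.single 1 ((i:ℕ) % B) : Fin 2 →₀ ℕ)) (by
      intro i j h
      have h0 := DFunLike.congr_fun h 0
      have h1 := DFunLike.congr_fun h 1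
      simp at h0 h1
      apply Fin.ext
      rw [← Nat.div_add_mod i B, ← Nat.div_add_mod j B, h0, h1])
  have hh : (fun i : Fin D => (phi B i : BP ℂ)) = (basisMonomials (Fin 2) ℂ) ∘
      (fun i : Fin D => (Finsupp.single 0 ((i:ℕ) / B) + Finsupp.single 1 ((i:ℕ) % B) : Fin 2 →₀ ℕ)) := by
    funext i
    simp [phi_eq]
  rw [hh]
  exact this

lemma degreeOf_phi (B i : ℕ) (hB : 0 < B) : degreeOf 1 (phi B i : BP ℂ) < B := by
  rw [phi_eq, degreeOf_lt_iff hB]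
  intro m hm
  rw [support_monomial] at hm
  simp at hm
  rw [hm]
  simp [Nat.mod_lt _ hB]

theorem quot_dim (f : BP ℂ) (hd : 0 < f.totalDegree) 
    (r s : BP ℂ ⧸ Ideal.span {f}) : ∃ m M : ℕ, ¬ LinearIndependent ℂ
      (fun ij : Fin (m+1) × Fin (M+1) => r ^ (ij.1 : ℕ) * s ^ (m - ij.1) *
        (Ideal.Quotient.mk (Ideal.span {f}) (X 0)) ^ (ij.2 : ℕ)) := by
  obtain ⟨r0, rfl⟩ := Ideal.Quotient.mk_surjective r
  obtain ⟨s0, rfl⟩ := Ideal.Quotient.mk_surjective s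
  set d := f.totalDegree with hdd
  set e := r0.totalDegree + s0.totalDegree + 1 with he
  refine ⟨2*d, 2*d*e+3, fun hli => ?_⟩
  set k := 2*d*e + (2*d*e+3) with hk
  have hdk : d ≤ k := by nlinarith
  let π : BP ℂ →ₐ[ℂ] (BP ℂ ⧸ Ideal.span {f}) := Ideal.Quotient.mkₐ ℂ _
  let T : PD k →ₗ[ℂ] (BP ℂ ⧸ Ideal.span {f}) := π.toLinearMap.comp (Submodule.subtype _)
  have hf0 : f ≠ 0 := by rintro rfl; simp at hdd; omega
  let μ : PD (k-d) →ₗ[ℂ] PD k := mulPD f (k-d) k (by omega)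
  have hμ : Function.Injective μ := by
    intro a b hab
    have : f * (a : BP ℂ) = f * b := by rw [← mulPD_apply f (k-d) k (by omega), ← mulPD_apply f (k-d) k (by omega)]; exact congrArg Subtype.val hab
    exact Subtype.ext (mul_left_cancel₀ hf0 this)
  have hr : LinearMap.range μ ≤ LinearMap.ker T := by
    rintro _ ⟨a, rfl⟩
    rw [LinearMap.mem_ker]
    change Ideal.Quotient.mk (Ideal.span {f}) (f * a) = 0
    rw [Ideal.Quotient.eq_zero_iff_mem, Ideal.mem_span_singleton]
    exact dvd_mul_right _ _
  have e1 := LinearMap.finrank_range_add_finrank_ker T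
  have e2 := Submodule.finrank_mono hr
  have e3 := LinearMap.finrank_range_of_inj hμ
  have e4 := finrank_PD k
  have e5 := finrank_PD (k-d)
  have e6 := finrank_span_eq_card hli
  have e7 : Submodule.span ℂ (Set.range (fun ij : Fin (2*d+1) × Fin (2*d*e+3+1) =>
      (Ideal.Quotient.mk (Ideal.span {f}) r0) ^ (ij.1 : ℕ) *
      (Ideal.Quotient.mk (Ideal.span {f}) s0) ^ (2*d - ij.1) *
        (Ideal.Quotient.mk (Ideal.span {f}) (X 0)) ^ (ij.2 : ℕ))) ≤ LinearMap.range T := by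
    rw [Submodule.span_le]
    rintro _ ⟨⟨i, j⟩, rfl⟩
    refine ⟨⟨r0 ^ (i:ℕ) * s0 ^ (2*d-i) * X 0 ^ (j:ℕ), ?_⟩, ?_⟩
    · change _ ∈ PD k
      rw [mem_restrictTotalDegree]
      refine (totalDegree_mul _ _).trans ?_
      refine (Nat.add_le_add (totalDegree_mul _ _) (totalDegree_pow _ _)).trans ?_
      have h1 := totalDegree_pow r0 i
      have h2 := totalDegree_pow s0 (2*d-i)
      have h3 : (X 0 : BP ℂ).totalDegree = 1 := totalDegree_X 0
      rw [h3]
      have h4 : (i:ℕ) * r0.totalDegree ≤ i * e := Nat.mul_le_mul_left _ (by omega)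
      have h5 : (2*d-i) * s0.totalDegree ≤ (2*d-i) * e := Nat.mul_le_mul_left _ (by omega)
      have h6 : i * e + (2*d-i) * e = 2*d*e := by rw [← add_mul]; congr 1; omega
      have := j.2
      omega
    · change Ideal.Quotient.mk (Ideal.span {f}) _ = _
      simp
  have e8 := Submodule.finrank_mono e7
  rw [e6] at e8
  simp only [Fintype.card_prod, Fintype.card_fin] at e8
  obtain ⟨l, hl⟩ : ∃ l, k = d + l := ⟨k - d, by omega⟩
  rw [e3] at e2
  have hkl : k - d = l := by omega
  clear_value μ
  clear e3 hr hμ μ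
  rw [hkl] at e2 e5
  have e9 : 2 * ((2*d+1)*(2*d*e+3+1)) + (l+1)*(l+2) ≤ (k+1)*(k+2) := by omega
  rw [hl] at e9
  have e10 : 2 * ((2*d+1)*(2*d*e+3+1)) ≤ d * (d + 2 * l + 3) := by nlinarith
  have e11 : d + 2 * l ≤ 2 * k := by omega
  have e12 : d * (d + 2 * l + 3) ≤ d * (2 * k + 3) := Nat.mul_le_mul_left _ (by omega)
  rw [hk] at e12
  nlinarith

theorem not_dvd_Wr (f h g : BP ℂ) (hf : Irreducible f) (hg : g = f * h)
    (hgy : ¬ f ∣ pderiv 1 g) (hd : 0 < f.totalDegree) (B D : ℕ) (hB : 0 < B) (hBf : B ≤ degreeOf 1 f) :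
    ¬ f ∣ Wr g B D := by
  have hprime : (Ideal.span {f}).IsPrime := by
    rw [Ideal.span_singleton_prime hf.ne_zero]; exact hf.prime
  let π : BP ℂ →ₐ[ℂ] (BP ℂ ⧸ Ideal.span {f}) := Ideal.Quotient.mkₐ ℂ _
  have hπ : Function.Surjective π := Ideal.Quotient.mk_surjective
  have hπ0 : ∀ q, π q = 0 ↔ f ∣ q := by
    intro q
    change Ideal.Quotient.mk (Ideal.span {f}) q = 0 ↔ _
    rw [Ideal.Quotient.eq_zero_iff_mem, Ideal.mem_span_singleton]
  let δ := Derivation.liftOfSurjective (f := π) hπ (d := dl g) (by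
    intro x hx
    rw [hπ0] at hx ⊢
    obtain ⟨q, rfl⟩ := hx
    have : dl g f = f * (pderiv 1 h * pderiv 0 f - pderiv 0 h * pderiv 1 f) := by
      rw [dl_apply, hg]
      simp only [Derivation.leibniz, smul_eq_mul]
      ring
    rw [Derivation.leibniz, this]
    simp only [smul_eq_mul]
    exact dvd_add (dvd_mul_right _ _) (Dvd.dvd.mul_left (dvd_mul_right _ _) _))
  have hδ : ∀ q, δ (π q) = π (dl g q) := fun q => Derivation.liftOfSurjective_apply _ _ _
  have hδi : ∀ (j : ℕ) q, (δ^[j]) (π q) = π (((dl g)^[j]) q) := by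
    intro j
    induction j with
    | zero => intro q; rfl
    | succ j ih => intro q; rw [Function.iterate_succ_apply', Function.iterate_succ_apply', ih, hδ]
  have hx : δ (π (X 0)) ≠ 0 := by
    rw [hδ, Ne, hπ0, dl_apply]
    simpa [pderiv_X_of_ne] using hgy
  have hli : LinearIndependent ℂ (fun i : Fin D => π (phi B i)) := by
    rw [Fintype.linearIndependent_iff]
    intro c hc
    have h1 : π (∑ i : Fin D, c i • phi B i) = 0 := by
      rw [map_sum, ← hc]; exact Finset.sum_congr rfl fun i _ => map_smul _ _ _
    rw [hπ0] at h1
    have h2 : ∑ i : Fin D, c i • (phi B i : BP ℂ) = 0 := by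
      by_contra hne
      obtain ⟨q, hq⟩ := h1
      have hq0 : q ≠ 0 := by rintro rfl; simp at hq; exact hne hq
      have h3 := degreeOf_mul_eq (n := 1) hf.ne_zero hq0
      rw [← hq] at h3
      have h4 : degreeOf 1 (∑ i : Fin D, c i • (phi B i : BP ℂ)) < B := by
        refine (degreeOf_sum_le _ _ _).trans_lt ?_
        rw [Finset.sup_lt_iff (by simpa using hB)]
        intro i _
        rw [smul_eq_C_mul]
        exact (degreeOf_C_mul_le _ _ _).trans_lt (degreeOf_phi B i hB)
      omega
    exact Fintype.linearIndependent_iff.mp (phi_li B D hB) c h2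
  have := wr_main δ (π (X 0)) hx (quot_dim f hd) D (fun i : Fin D => π (phi B i)) hli
  rw [← hπ0]
  intro hW
  apply this
  rw [← hW, Wr]
  change _ = π.toRingHom _
  rw [RingHom.map_det]
  congr 1
  ext1 i j
  simp only [Matrix.of_apply, hδi]
  rfl


section evals
variable {R : Type} [CommRing R]

/-- Evaluation of an integral bivariate polynomial at a point of a ring. -/
noncomputable def ev (a b : R) : BP ℤ →ₐ[ℤ] R := aeval ![a, b]

@[simp] lemma ev_X0 (a b : R) : ev a b (X 0) = a := by simp [ev]
@[simp] lemma ev_X1 (a b : R) : ev a b (X 1) = b := by simp [ev]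
lemma ev_C (a b : R) (n : ℤ) : ev a b (C n) = (n : R) := by simp [ev]

lemma ev_map {S : Type} [CommRing S] (ψ : R →+* S) (a b : R) (q : BP ℤ) :
    ψ (ev a b q) = ev (ψ a) (ψ b) q := by
  have : ψ.toIntAlgHom.comp (ev a b) = ev (ψ a) (ψ b) := by
    apply MvPolynomial.algHom_ext
    intro i
    fin_cases i <;> simp
  exact DFunLike.congr_fun this q

lemma fin2_cases (i : Fin 2) : i = 0 ∨ i = 1 := by omega

lemma ev_taylor (a b e : R) (q : BP ℤ) :
    ∃ r, ev a (b + e) q = ev a b q + ev a b (pderiv 1 q) * e + r * e ^ 2 := by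
  induction q using MvPolynomial.induction_on with
  | C n => exact ⟨0, by simp [ev_C]⟩
  | add p q hp hq =>
    obtain ⟨r, hr⟩ := hp
    obtain ⟨s, hs⟩ := hq
    exact ⟨r + s, by simp only [map_add, hr, hs]; ring⟩
  | mul_X p i hp =>
    obtain ⟨r, hr⟩ := hp
    rcases fin2_cases i with rfl | rfl
    · refine ⟨r * a, ?_⟩
      simp only [map_mul, hr, ev_X0, Derivation.leibniz, smul_eq_mul, map_add,
        pderiv_X_of_ne (show (0 : Fin 2) ≠ 1 by decide), map_zero]
      ring
    · refine ⟨r * b + ev a b (pderiv 1 p) + r * e, ?_⟩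
      simp only [map_mul, hr, ev_X1, Derivation.leibniz, smul_eq_mul, map_add, pderiv_X_self, map_one]
      ring

lemma ev_congr (m a b a' b' : R) (ha : m ∣ a' - a) (hb : m ∣ b' - b) (q : BP ℤ) :
    m ∣ ev a' b' q - ev a b q := by
  rw [← Ideal.mem_span_singleton, ← Ideal.Quotient.eq] at *
  rw [ev_map, ev_map, ha, hb]

lemma ev_deriv (Y : Polynomial R) (q : BP ℤ) :
    Polynomial.derivative (ev Polynomial.X Y q) = ev Polynomial.X Y (pderiv 0 q) +
      ev Polynomial.X Y (pderiv 1 q) * Polynomial.derivative Y := by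
  induction q using MvPolynomial.induction_on with
  | C n => simp [ev_C]
  | add p q hp hq => simp only [map_add, hp, hq]; ring
  | mul_X p i hp =>
    rcases fin2_cases i with rfl | rfl
    · simp only [map_mul, ev_X0, Derivation.leibniz, smul_eq_mul, map_add, hp,
        pderiv_X_of_ne (show (0 : Fin 2) ≠ 1 by decide), pderiv_X_self, map_zero, map_one,
        Polynomial.derivative_mul, Polynomial.derivative_X]
      ring
    · simp only [map_mul, ev_X1, Derivation.leibniz, smul_eq_mul, map_add, hp,
        pderiv_X_of_ne (show (1 : Fin 2) ≠ 0 by decide), pderiv_X_self, map_zero, map_one,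
        Polynomial.derivative_mul]
      ring

lemma ev_dl (Y : Polynomial R) (g q : BP ℤ) :
    ev Polynomial.X Y (dl g q) = ev Polynomial.X Y (pderiv 1 g) * Polynomial.derivative (ev Polynomial.X Y q)
      - ev Polynomial.X Y (pderiv 1 q) * Polynomial.derivative (ev Polynomial.X Y g) := by
  rw [ev_deriv, ev_deriv, dl_apply]
  simp only [map_sub, map_mul]
  ring
end evals

section local_part
variable (p : ℕ) [hpf : Fact p.Prime]
theorem hensel (g : BP ℤ) (x0 y0 : ℤ) (hg : (p : ℤ) ∣ ev x0 y0 g)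
    (hgy : ¬ (p : ℤ) ∣ ev x0 y0 (pderiv 1 g)) (m : ℕ) : ∃ Y : Polynomial ℤ,
      (p : ℤ) ∣ Y.eval x0 - y0 ∧
      ((Polynomial.X - Polynomial.C (x0 : ZMod p)) ^ (m+1) ∣
        ev Polynomial.X (Y.map (Int.castRingHom (ZMod p))) g) ∧
      ∀ x y : ℤ, (p : ℤ) ∣ x - x0 → (p : ℤ) ∣ y - y0 → ev x y g = 0 →
        (p : ℤ) ^ (m+1) ∣ y - Y.eval x := by
  obtain ⟨u, hu⟩ : ∃ u : ℤ, (p : ℤ) ∣ 1 - u * ev x0 y0 (pderiv 1 g) := by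
    have hc : IsCoprime (p : ℤ) (ev x0 y0 (pderiv 1 g)) :=
      (Prime.coprime_iff_not_dvd (Nat.prime_iff_prime_int.mp hpf.out)).mpr hgy
    obtain ⟨a, b, hab⟩ := hc
    exact ⟨b, a, by linear_combination -hab⟩
  have hev : ∀ (Y : Polynomial ℤ) (x : ℤ) (q : BP ℤ), (ev Polynomial.X Y q).eval x = ev x (Y.eval x) q := by
    intro Y x q
    have := ev_map (Polynomial.evalRingHom x) Polynomial.X Y q
    simpa using this
  have hevp : ∀ (Y : Polynomial (ZMod p)) (x : ZMod p) (q : BP ℤ), (ev Polynomial.X Y q).eval x = ev x (Y.eval x) q := by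
    intro Y x q
    have := ev_map (Polynomial.evalRingHom x) Polynomial.X Y q
    simpa using this
  have hcast : ∀ (q : BP ℤ) (x y : ℤ), ev (x : ZMod p) (y : ZMod p) q = ((ev x y q : ℤ) : ZMod p) := by
    intro q x y
    have := ev_map (Int.castRingHom (ZMod p)) x y q
    simpa using this.symm
  have hYc : ∀ (Y : Polynomial ℤ), (p : ℤ) ∣ Y.eval x0 - y0 →
      (Y.map (Int.castRingHom (ZMod p))).eval (x0 : ZMod p) = (y0 : ZMod p) := by
    intro Y hY
    have h1 := (ZMod.intCast_zmod_eq_zero_iff_dvd _ _).mpr hY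
    push_cast at h1
    rw [← sub_eq_zero, ← h1]
    congr 1
    have := Polynomial.eval_map_apply (f := Int.castRingHom (ZMod p)) (p := Y) x0
    simpa using this
  induction m with
  | zero =>
    refine ⟨Polynomial.C y0, by simp, ?_, ?_⟩
    · rw [zero_add, pow_one, Polynomial.dvd_iff_isRoot, Polynomial.IsRoot.def, hevp, hYc _ (by simp), hcast]
      exact (ZMod.intCast_zmod_eq_zero_iff_dvd _ _).mpr hg
    · intro x y hx hy _
      simpa using hy
  | succ m ih =>
    obtain ⟨Y, h1, h2, h3⟩ := ih
    refine ⟨Y - Polynomial.C u * ev Polynomial.X Y g, ?_, ?_, ?_⟩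
    · have := ev_congr (p : ℤ) x0 y0 x0 (Y.eval x0) (by simp) h1 g
      have h4 : (p : ℤ) ∣ ev x0 (Y.eval x0) g := (dvd_sub_left hg).mp this
      simp only [Polynomial.eval_sub, Polynomial.eval_mul, Polynomial.eval_C, hev]
      have := dvd_sub h1 (Dvd.dvd.mul_left h4 u)
      rwa [sub_right_comm] at this
    · have hG : (ev Polynomial.X Y g).map (Int.castRingHom (ZMod p)) =
          ev Polynomial.X (Y.map (Int.castRingHom (ZMod p))) g := by
        have := ev_map (Polynomial.mapRingHom (Int.castRingHom (ZMod p))) Polynomial.X Y g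
        simpa using this
      rw [Polynomial.map_sub, Polynomial.map_mul, hG, Polynomial.map_C]
      set Yb := Y.map (Int.castRingHom (ZMod p))
      set G := ev Polynomial.X Yb g with hGd
      obtain ⟨r, hr⟩ := ev_taylor Polynomial.X Yb (-(Polynomial.C ((Int.castRingHom (ZMod p)) u) * G)) g
      rw [sub_eq_add_neg Yb, hr, ← hGd]
      set t := Polynomial.X - Polynomial.C (x0 : ZMod p) with ht
      have h5 : t ∣ 1 - Polynomial.C ((Int.castRingHom (ZMod p)) u) * ev Polynomial.X Yb (pderiv 1 g) := by
        rw [ht, Polynomial.dvd_iff_isRoot, Polynomial.IsRoot.def]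
        simp only [Polynomial.eval_sub, Polynomial.eval_mul, Polynomial.eval_C, Polynomial.eval_one, hevp,
          Yb, hYc _ h1, hcast]
        have := (ZMod.intCast_zmod_eq_zero_iff_dvd _ _).mpr hu
        simpa using this
      obtain ⟨v, hv⟩ := h5
      obtain ⟨w, hw⟩ := h2
      refine ⟨w * v + r * (Polynomial.C ((Int.castRingHom (ZMod p)) u))^2 * w ^ 2 * t ^ m, ?_⟩
      have e1 : G + ev Polynomial.X Yb (pderiv 1 g) * -(Polynomial.C ((Int.castRingHom (ZMod p)) u) * G)
        = G * (1 - Polynomial.C ((Int.castRingHom (ZMod p)) u) * ev Polynomial.X Yb (pderiv 1 g)) := by ring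
      rw [e1, hv, hw]
      ring
    · intro x y hx hy hxy
      obtain ⟨e, he⟩ := h3 x y hx hy hxy
      obtain ⟨r, hr⟩ := ev_taylor x (Y.eval x) ((p:ℤ)^(m+1) * e) g
      rw [← he, add_sub_cancel, hxy, he] at hr
      have h4 : (p : ℤ) ∣ y0 - Y.eval x := by
        have : (p : ℤ) ∣ y - Y.eval x := he ▸ Dvd.dvd.mul_right (dvd_pow_self _ (by omega)) _
        have := dvd_sub this hy
        rwa [show y - Y.eval x - (y - y0) = y0 - Y.eval x by ring] at this
      have h5 : (p : ℤ) ∣ Y.eval x - y0 := by rw [← dvd_neg]; simpa using h4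
      obtain ⟨v, hv⟩ := ev_congr (p : ℤ) x0 y0 x (Y.eval x) hx h5 (pderiv 1 g)
      obtain ⟨w, hw⟩ := hu
      simp only [Polynomial.eval_sub, Polynomial.eval_mul, Polynomial.eval_C, hev]
      refine ⟨e * (w - u * v) - u * r * e^2 * (p:ℤ)^m, ?_⟩
      have e1 : y - (Y.eval x - u * ev x (Y.eval x) g) = (y - Y.eval x) + u * ev x (Y.eval x) g := by ring
      rw [e1, he]
      linear_combination (-u) * hr + (p:ℤ)^(m+1) * e * hw - u * (p:ℤ)^(m+1) * e * hv

theorem coeff_indep (g : BP ℤ) (x0 y0 : ℤ) (B D : ℕ)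
    (hW : ¬ (p : ℤ) ∣ ev x0 y0 (Wr g B D)) (Y : Polynomial (ZMod p))
    (hY : Y.eval (x0 : ZMod p) = y0)
    (hg : (Polynomial.X - Polynomial.C (x0 : ZMod p)) ^ D ∣ ev Polynomial.X Y g)
    (c : Fin D → ZMod p)
    (hc : (Polynomial.X - Polynomial.C (x0 : ZMod p)) ^ D ∣
      ∑ i : Fin D, Polynomial.C (c i) * ev Polynomial.X Y (phi B i)) : c = 0 := by
  have hevp : ∀ (q : BP ℤ), (ev Polynomial.X Y q).eval (x0 : ZMod p) = ((ev x0 y0 q : ℤ) : ZMod p) := by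
    intro q
    have := ev_map (Polynomial.evalRingHom (x0 : ZMod p)) Polynomial.X Y q
    have h2 := ev_map (Int.castRingHom (ZMod p)) x0 y0 q
    simp [hY] at this h2
    rw [this, h2]
  set t := Polynomial.X - Polynomial.C (x0 : ZMod p) with ht
  choose a ha using fun i => ZMod.intCast_surjective (n := p) (c i)
  set F : BP ℤ := ∑ i : Fin D, C (a i) * phi B i with hF
  have hF' : ev Polynomial.X Y F = ∑ i : Fin D, Polynomial.C (c i) * ev Polynomial.X Y (phi B i) := by
    rw [hF, map_sum]
    refine Finset.sum_congr rfl fun i _ => ?_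
    rw [map_mul, ev_C, ← ha i]
    simp
  rw [← hF'] at hc
  have hder : ∀ (q : Polynomial (ZMod p)) (k : ℕ), t ^ (k+1) ∣ q → t ^ k ∣ Polynomial.derivative q := by
    rintro _ k ⟨w, rfl⟩
    rw [Polynomial.derivative_mul, Polynomial.derivative_pow]
    refine dvd_add ?_ ?_
    · exact Dvd.dvd.mul_right (Dvd.dvd.mul_right (by simp) _) _
    · exact Dvd.dvd.mul_right (pow_dvd_pow _ (by omega)) _
  have hiter : ∀ j, j ≤ D → t ^ (D - j) ∣ ev Polynomial.X Y (((dl g)^[j]) F) := by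
    intro j
    induction j with
    | zero => intro _; simpa using hc
    | succ j ih =>
      intro hj
      have h1 := ih (by omega)
      rw [Function.iterate_succ_apply', ev_dl]
      refine dvd_sub (Dvd.dvd.mul_left (hder _ _ ?_) _) (Dvd.dvd.mul_left (hder _ _ ?_) _)
      · rwa [show D - (j+1) + 1 = D - j by omega]
      · exact (pow_dvd_pow _ (by omega)).trans hg
  have hlin : ∀ j, ((dl g)^[j]) F = ∑ i : Fin D, C (a i) * ((dl g)^[j]) (phi B i) := by
    intro j
    induction j with
    | zero => rfl
    | succ j ih =>
      rw [Function.iterate_succ_apply', ih, map_sum]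
      refine Finset.sum_congr rfl fun i _ => ?_
      rw [Function.iterate_succ_apply', ← smul_eq_C_mul, ← smul_eq_C_mul, Derivation.map_smul]
  have hz : ∀ j : Fin D, ∑ i : Fin D, c i * ((ev x0 y0 (((dl g)^[(j:ℕ)]) (phi B i)) : ℤ) : ZMod p) = 0 := by
    intro j
    have h1 := hiter j j.2.le
    have h2 : t ∣ ev Polynomial.X Y (((dl g)^[(j:ℕ)]) F) := (dvd_pow_self _ (by omega)).trans h1
    rw [ht, Polynomial.dvd_iff_isRoot, Polynomial.IsRoot.def, hevp, hlin, map_sum] at h2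
    rw [← h2]
    push_cast
    refine Finset.sum_congr rfl fun i _ => ?_
    rw [map_mul, ev_C, Int.cast_mul, ← ha i]
    simp
  by_contra hne
  apply hW
  rw [← ZMod.intCast_zmod_eq_zero_iff_dvd]
  have hdet : (Matrix.of fun i j : Fin D => ((ev x0 y0 (((dl g)^[(j:ℕ)]) (phi B i)) : ℤ) : ZMod p)).det = 0 := by
    apply Matrix.exists_vecMul_eq_zero_iff.mp
    refine ⟨c, hne, ?_⟩
    ext j
    simpa [Matrix.vecMul, dotProduct] using hz j
  rw [← hdet, Wr]
  change (Int.castRingHom (ZMod p)) ((ev x0 y0).toRingHom _) = _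
  rw [RingHom.map_det, RingHom.map_det]
  rfl
end local_part


lemma vand_dvd (p : ℤ) (D : ℕ) (x : Fin D → ℤ) (hx : ∀ i j, p ∣ x j - x i) :
    p ^ (D * (D - 1) / 2) ∣ (Matrix.vandermonde x).det := by
  rw [Matrix.det_vandermonde]
  have h1 : ∀ i : Fin D, p ^ (Finset.Ioi i).card ∣ ∏ j ∈ Finset.Ioi i, (x j - x i) := by
    intro i
    rw [← Finset.prod_const]
    exact Finset.prod_dvd_prod_of_dvd _ _ fun j _ => hx i j
  have h2 := Finset.prod_dvd_prod_of_dvd _ _ (fun i (_ : i ∈ Finset.univ) => h1 i)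
  rw [Finset.prod_pow_eq_pow_sum] at h2
  have h3 : D * (D - 1) / 2 = ∑ i : Fin D, (Finset.Ioi i).card := by
    simp only [Fin.card_Ioi]
    rw [Fin.sum_univ_eq_sum_range (fun i => D - 1 - i) D, Finset.sum_range_reflect (fun i => i) D,
      Finset.sum_range_id]
  rw [h3]
  exact h2

lemma det_bound (N B D : ℕ) (Q : Fin D → ℤ × ℤ) (hN : ∀ l, |(Q l).1| ≤ N ∧ |(Q l).2| ≤ N) :
    |(Matrix.of fun i l : Fin D => ev (Q l).1 (Q l).2 (phi B i)).det| ≤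
      (D.factorial : ℤ) * (N : ℤ) ^ (∑ i ∈ Finset.range D, (i / B + i % B)) := by
  rw [← Matrix.det_transpose, Matrix.det_apply]
  refine (Finset.abs_sum_le_sum_abs _ _).trans ?_
  have hb : ∀ σ : Equiv.Perm (Fin D), |Equiv.Perm.sign σ • ∏ i, (Matrix.of fun i l : Fin D => ev (Q l).1 (Q l).2 (phi B i : BP ℤ)).transpose (σ i) i| ≤ (N : ℤ) ^ (∑ i ∈ Finset.range D, (i / B + i % B)) := by
    intro σ
    rw [Units.smul_def, smul_eq_mul, abs_mul, Int.isUnit_iff_abs_eq.mp (Equiv.Perm.sign σ).isUnit, one_mul, Finset.abs_prod,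
      ← Fin.sum_univ_eq_sum_range (fun i => i / B + i % B) D, ← Finset.prod_pow_eq_pow_sum]
    refine Finset.prod_le_prod (fun _ _ => abs_nonneg _) fun i _ => ?_
    simp only [Matrix.transpose_apply, Matrix.of_apply, phi, map_mul, map_pow, ev_X0, ev_X1]
    rw [abs_mul, abs_pow, abs_pow, pow_add]
    gcongr
    · exact (hN _).1
    · exact (hN _).2
  refine (Finset.sum_le_sum fun σ _ => hb σ).trans ?_
  rw [Finset.sum_const, Finset.card_univ, Fintype.card_perm, Fintype.card_fin, nsmul_eq_mul]

theorem local_count (p : ℕ) [hpf : Fact p.Prime] (g : BP ℤ) (x0 y0 : ℤ) (B D N : ℕ)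
    (hg : (p : ℤ) ∣ ev x0 y0 g) (hgy : ¬ (p : ℤ) ∣ ev x0 y0 (pderiv 1 g))
    (hW : ¬ (p : ℤ) ∣ ev x0 y0 (Wr g B D))
    (hp : D.factorial * N ^ (∑ i ∈ Finset.range D, (i / B + i % B)) < p ^ (D * (D - 1) / 2))
    (Q : Fin D → ℤ × ℤ) (hQ : Function.Injective Q)
    (hQg : ∀ l, ev (Q l).1 (Q l).2 g = 0)
    (hN : ∀ l, |(Q l).1| ≤ N ∧ |(Q l).2| ≤ N)
    (hx : ∀ l, (p : ℤ) ∣ (Q l).1 - x0) (hy : ∀ l, (p : ℤ) ∣ (Q l).2 - y0) : False := by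
  set x : Fin D → ℤ := fun l => (Q l).1 with hxd
  set V := (Matrix.vandermonde x).det with hV
  set m := D + D * (D - 1) / 2 + 2 * N + V.natAbs with hm
  obtain ⟨Y, hY1, hY2, hY3⟩ := hensel p g x0 y0 hg hgy m
  have hp2 : 2 ≤ p := hpf.out.two_le
  have hpm : m + 1 < p ^ (m+1) := Nat.lt_pow_self hp2
  -- distinct abscissae
  have hxinj : Function.Injective x := by
    intro k l hkl
    apply hQ
    refine Prod.ext hkl ?_
    have h1 := hY3 _ _ (hx k) (hy k) (hQg k)
    have h2 := hY3 _ _ (hx l) (hy l) (hQg l)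
    have h3 := dvd_sub h1 h2
    have hkl' : (Q k).1 = (Q l).1 := hkl
    rw [hkl', sub_sub_sub_cancel_right] at h3
    have h4 := Int.eq_zero_of_abs_lt_dvd h3 (by
      have h5 := hN k
      have h6 := hN l
      have : |(Q k).2 - (Q l).2| ≤ 2 * N := by
        refine (abs_sub _ _).trans ?_
        linarith [h5.2, h6.2]
      have h7 : ((2 * N : ℕ) : ℤ) < ((p ^ (m+1) : ℕ) : ℤ) := by
        exact_mod_cast (by omega : 2 * N < p ^ (m+1))
      push_cast at h7
      linarith)
    linarith
  have hV0 : V ≠ 0 := Matrix.det_vandermonde_ne_zero_iff.mpr hxinj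
  have hpV : (p : ℤ) ^ (D * (D - 1) / 2) ∣ V := vand_dvd _ _ _ (by
    intro i j
    have := dvd_sub (hx j) (hx i)
    rwa [sub_sub_sub_cancel_right] at this)
  -- remainders
  set q : Polynomial ℤ := ∏ l, (Polynomial.X - Polynomial.C (x l)) with hq
  have hqm : q.Monic := Polynomial.monic_prod_of_monic _ _ fun l _ => Polynomial.monic_X_sub_C _
  have hqd : q.natDegree = D := by
    rw [hq, Polynomial.natDegree_prod_of_monic _ _ fun l _ => Polynomial.monic_X_sub_C _]
    simp only [Polynomial.natDegree_X_sub_C]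
    simp
  set Φ : Fin D → Polynomial ℤ := fun i => ev Polynomial.X Y (phi B i) with hΦ
  set ρ : Fin D → Polynomial ℤ := fun i => Φ i %ₘ q with hρ
  have hρd : ∀ i, (ρ i).degree < D := by
    intro i
    have := Polynomial.degree_modByMonic_lt (Φ i) hqm
    rwa [Polynomial.degree_eq_natDegree hqm.ne_zero, hqd] at this
  set E : Matrix (Fin D) (Fin D) ℤ := Matrix.of fun i j => (ρ i).coeff j with hE
  have hprod : (Matrix.of fun i l : Fin D => (Φ i).eval (x l)) = E * (Matrix.vandermonde x).transpose := by
    ext i l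
    rw [Matrix.mul_apply]
    simp only [Matrix.of_apply, Matrix.transpose_apply, Matrix.vandermonde_apply, hE]
    have h1 : (Φ i).eval (x l) = (ρ i).eval (x l) := by
      conv_lhs => rw [← Polynomial.modByMonic_add_div (Φ i) q]
      have : q.eval (x l) = 0 := by
        rw [hq, Polynomial.eval_prod]
        exact Finset.prod_eq_zero (Finset.mem_univ l) (by simp)
      simp [this, hρ]
    rw [h1]
    by_cases h0 : ρ i = 0
    · simp [h0]
    · rw [Polynomial.eval_eq_sum_range' (n := D) ((Polynomial.natDegree_lt_iff_degree_lt h0).mpr (hρd i)),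
        ← Fin.sum_univ_eq_sum_range (fun j => (ρ i).coeff j * x l ^ j) D]
  have hdet1 : (Matrix.of fun i l : Fin D => (Φ i).eval (x l)).det = E.det * V := by
    rw [hprod, Matrix.det_mul, Matrix.det_transpose]
  -- the determinant of coefficients is a unit mod p
  have hEp : ¬ (p : ℤ) ∣ E.det := by
    rw [← ZMod.intCast_zmod_eq_zero_iff_dvd]
    intro h0
    have h1 : (E.map (Int.castRingHom (ZMod p))).det = 0 := by
      rw [← h0]
      exact (RingHom.map_det (Int.castRingHom (ZMod p)) E).symm
    obtain ⟨c, hc0, hc⟩ := Matrix.exists_vecMul_eq_zero_iff.mpr h1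
    apply hc0
    set Yb := Y.map (Int.castRingHom (ZMod p)) with hYb
    refine coeff_indep p g x0 y0 B D hW Yb ?_ ((pow_dvd_pow _ (by omega)).trans hY2) c ?_
    · have h1 := (ZMod.intCast_zmod_eq_zero_iff_dvd _ _).mpr hY1
      push_cast at h1
      rw [← sub_eq_zero, ← h1]
      congr 1
      exact Polynomial.eval_map_apply (f := Int.castRingHom (ZMod p)) (p := Y) x0
    · have hqb : q.map (Int.castRingHom (ZMod p)) = (Polynomial.X - Polynomial.C (x0 : ZMod p)) ^ D := by
        rw [hq, Polynomial.map_prod]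
        have : ∀ l : Fin D, (Polynomial.X - Polynomial.C (x l)).map (Int.castRingHom (ZMod p)) =
            Polynomial.X - Polynomial.C (x0 : ZMod p) := by
          intro l
          have h2 := (ZMod.intCast_zmod_eq_zero_iff_dvd _ _).mpr (hx l)
          push_cast at h2
          rw [sub_eq_zero] at h2
          rw [Polynomial.map_sub, Polynomial.map_X, Polynomial.map_C]
          congr 2
        rw [Finset.prod_congr rfl fun l _ => this l]
        simp only [Finset.prod_const, Finset.card_univ, Fintype.card_fin]
      have hΦb : ∀ i : Fin D, ev Polynomial.X Yb (phi B i) = (ρ i).map (Int.castRingHom (ZMod p)) +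
          (Polynomial.X - Polynomial.C (x0 : ZMod p)) ^ D * (Φ i /ₘ q).map (Int.castRingHom (ZMod p)) := by
        intro i
        rw [← hqb, ← Polynomial.map_mul, ← Polynomial.map_add, hρ, Polynomial.modByMonic_add_div]
        have := ev_map (Polynomial.mapRingHom (Int.castRingHom (ZMod p))) Polynomial.X Y (phi B i)
        simp at this
        exact this.symm
      have hz : ∑ i : Fin D, Polynomial.C (c i) * (ρ i).map (Int.castRingHom (ZMod p)) = 0 := by
        ext j
        rw [Polynomial.finsetSum_coeff]
        simp only [Polynomial.coeff_C_mul, Polynomial.coeff_map, Polynomial.coeff_zero]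
        by_cases hj : j < D
        · have := congrFun hc ⟨j, hj⟩
          simpa [Matrix.vecMul, dotProduct, hE] using this
        · refine Finset.sum_eq_zero fun i _ => ?_
          rw [Polynomial.coeff_eq_zero_of_degree_lt ((hρd i).trans_le (by exact_mod_cast not_lt.mp hj))]
          simp
      simp only [hΦb, mul_add, Finset.sum_add_distrib, hz, zero_add]
      refine Finset.dvd_sum fun i _ => ?_
      exact Dvd.dvd.mul_left (dvd_mul_right _ _) _
  -- comparison of determinants
  set Δ := (Matrix.of fun i l : Fin D => ev (Q l).1 (Q l).2 (phi B i)).det with hΔ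
  have hcong : (p : ℤ) ^ (m+1) ∣ Δ - E.det * V := by
    rw [← hdet1, hΔ, ← Ideal.mem_span_singleton, ← Ideal.Quotient.eq, RingHom.map_det, RingHom.map_det]
    congr 1
    ext i l
    simp only [RingHom.mapMatrix_apply, Matrix.map_apply, Matrix.of_apply]
    rw [Ideal.Quotient.eq, Ideal.mem_span_singleton]
    have := ev_map (Polynomial.evalRingHom (x l)) Polynomial.X Y (phi B i)
    simp only [Polynomial.coe_evalRingHom, Polynomial.eval_X] at this
    rw [hΦ]
    simp only [this]
    exact ev_congr _ _ _ _ _ (by simp [hxd]) (hY3 _ _ (hx l) (hy l) (hQg l)) _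
  have hΔ0 : Δ = 0 := by
    have h1 : (p : ℤ) ^ (D * (D - 1) / 2) ∣ Δ := by
      have h2 := (pow_dvd_pow (p : ℤ) (show D * (D-1)/2 ≤ m+1 by omega)).trans hcong
      exact (dvd_sub_left (Dvd.dvd.mul_left hpV _)).mp h2
    refine Int.eq_zero_of_abs_lt_dvd h1 ((det_bound N B D Q hN).trans_lt ?_)
    exact_mod_cast hp
  rw [hΔ0, zero_sub, dvd_neg] at hcong
  have hcop : IsCoprime ((p : ℤ) ^ (m+1)) E.det :=
    ((Prime.coprime_iff_not_dvd (Nat.prime_iff_prime_int.mp hpf.out)).mpr hEp).pow_left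
  have h1 := hcop.dvd_of_dvd_mul_left hcong
  apply hV0
  refine Int.eq_zero_of_abs_lt_dvd h1 ?_
  rw [Int.abs_eq_natAbs]
  exact_mod_cast (by omega : V.natAbs < p ^ (m+1))


section
variable {R : Type} [CommRing R]

lemma ev_deriv2 (a : R) (q : BP ℤ) :
    Polynomial.derivative (ev (Polynomial.C a) Polynomial.X q) =
      ev (Polynomial.C a) Polynomial.X (pderiv 1 q) := by
  induction q using MvPolynomial.induction_on with
  | C n => simp
  | add p q hp hq => simp only [map_add, hp, hq]
  | mul_X p i hp =>
    rcases fin2_cases i with rfl | rfl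
    · simp only [map_mul, ev_X0, Derivation.leibniz, smul_eq_mul, map_add, hp,
        pderiv_X_of_ne (show (0 : Fin 2) ≠ 1 by decide), map_zero,
        Polynomial.derivative_mul, Polynomial.derivative_C]
      ring
    · simp only [map_mul, ev_X1, Derivation.leibniz, smul_eq_mul, map_add, hp,
        pderiv_X_self, map_one, Polynomial.derivative_mul, Polynomial.derivative_X]
      ring

lemma natDegree_ev (a : R) (q : BP ℤ) :
    (ev (Polynomial.C a) Polynomial.X q).natDegree ≤ q.totalDegree := by
  rw [ev, aeval_def, eval₂_eq']
  refine Polynomial.natDegree_sum_le_of_forall_le _ _ fun m hm => ?_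
  rw [Fin.prod_univ_two]
  have h1 : m 1 ≤ q.totalDegree := by
    have := le_totalDegree hm
    rw [Finsupp.sum_fintype _ _ (fun _ => rfl), Fin.sum_univ_two] at this
    omega
  refine le_trans ?_ h1
  have h2 : algebraMap ℤ (Polynomial R) (coeff m q) * (Polynomial.C a ^ m 0 * Polynomial.X ^ m 1) =
      Polynomial.C ((coeff m q : ℤ) * a ^ m 0 : R) * Polynomial.X ^ m 1 := by
    simp [mul_assoc]
  change (algebraMap ℤ (Polynomial R) (coeff m q) * (Polynomial.C a ^ m 0 * Polynomial.X ^ m 1)).natDegree ≤ _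
  rw [h2]
  exact Polynomial.natDegree_C_mul_X_pow_le _ _
end

theorem good_count (p : ℕ) [hpf : Fact p.Prime] (g : BP ℤ) (B D N G : ℕ) (hG : g.totalDegree ≤ G)
    (hp : D.factorial * N ^ (∑ i ∈ Finset.range D, (i / B + i % B)) < p ^ (D * (D - 1) / 2))
    (T : Finset (ℤ × ℤ))
    (hT : ∀ z ∈ T, ev z.1 z.2 g = 0 ∧ ¬ (p : ℤ) ∣ ev z.1 z.2 (pderiv 1 g) ∧
      ¬ (p : ℤ) ∣ ev z.1 z.2 (Wr g B D) ∧ |z.1| ≤ N ∧ |z.2| ≤ N) :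
    T.card ≤ D * (G * p) := by
  classical
  let r : ℤ × ℤ → ZMod p × ZMod p := fun z => ((z.1 : ZMod p), (z.2 : ZMod p))
  have hcast : ∀ (q : BP ℤ) (x y : ℤ), ev (x : ZMod p) (y : ZMod p) q = ((ev x y q : ℤ) : ZMod p) := by
    intro q x y
    have := ev_map (Int.castRingHom (ZMod p)) x y q
    simpa using this.symm
  have hevp : ∀ (a b : ZMod p) (q : BP ℤ),
      (ev (Polynomial.C a) Polynomial.X q).eval b = ev a b q := by
    intro a b q
    have := ev_map (Polynomial.evalRingHom b) (Polynomial.C a) Polynomial.X q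
    simpa using this
  have h1 : T.card ≤ D * (T.image r).card := by
    refine Finset.card_le_mul_card_image T D fun w hw => ?_
    obtain ⟨z, hz, rfl⟩ := Finset.mem_image.mp hw
    by_contra hcon
    push Not at hcon
    obtain ⟨s, hs, hsc⟩ := Finset.exists_subset_card_eq hcon.le
    obtain ⟨hz1, hz2, hz3, -, -⟩ := hT z hz
    let e := s.equivFinOfCardEq hsc
    have hm : ∀ l, ((e.symm l : ℤ × ℤ) ∈ T) ∧ r (e.symm l) = r z := fun l => by
      have := hs (e.symm l).2
      simpa using this
    refine local_count p g z.1 z.2 B D N (by rw [hz1]; exact dvd_zero _) hz2 hz3 hp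
      (fun l => (e.symm l : ℤ × ℤ)) (Subtype.val_injective.comp e.symm.injective)
      (fun l => (hT _ (hm l).1).1) (fun l => (hT _ (hm l).1).2.2.2) (fun l => ?_) (fun l => ?_)
    · have := congrArg Prod.fst (hm l).2
      rw [← ZMod.intCast_zmod_eq_zero_iff_dvd, Int.cast_sub, sub_eq_zero]
      exact this
    · have := congrArg Prod.snd (hm l).2
      rw [← ZMod.intCast_zmod_eq_zero_iff_dvd, Int.cast_sub, sub_eq_zero]
      exact this
  have h2 : (T.image r).card ≤ G * ((T.image r).image Prod.fst).card := by
    refine Finset.card_le_mul_card_image (T.image r) G fun a ha => ?_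
    obtain ⟨w, hw, rfl⟩ := Finset.mem_image.mp ha
    obtain ⟨z, hz, rfl⟩ := Finset.mem_image.mp hw
    set u := ev (Polynomial.C (z.1 : ZMod p)) Polynomial.X g with hu
    have hu0 : u ≠ 0 := by
      intro h0
      have h3 := ev_deriv2 (z.1 : ZMod p) g
      rw [← hu, h0, Polynomial.derivative_zero] at h3
      have h4 := hevp z.1 z.2 (pderiv 1 g)
      rw [← h3, Polynomial.eval_zero, hcast] at h4
      exact (hT z hz).2.1 ((ZMod.intCast_zmod_eq_zero_iff_dvd _ _).mp h4.symm)
    calc _ ≤ u.roots.toFinset.card := by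
            refine Finset.card_le_card_of_injOn Prod.snd ?_ ?_
            · intro w hw
              simp only [Finset.coe_filter, Set.mem_ofPred_eq] at hw
              obtain ⟨hw1, hw2⟩ := hw
              obtain ⟨z', hz', rfl⟩ := Finset.mem_image.mp hw1
              rw [Finset.mem_coe, Multiset.mem_toFinset, Polynomial.mem_roots hu0, Polynomial.IsRoot.def, hu, hevp]
              have hw2' : ((z'.1 : ℤ) : ZMod p) = z.1 := hw2
              rw [← hw2', hcast, (hT z' hz').1]
              simp
            · intro w hw w' hw' h
              simp only [Finset.coe_filter, Set.mem_ofPred_eq] at hw hw'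
              exact Prod.ext (hw.2.trans hw'.2.symm) h
      _ ≤ u.natDegree := (Multiset.toFinset_card_le _).trans (Polynomial.card_roots' _)
      _ ≤ G := (natDegree_ev _ _).trans hG
  have h3 : ((T.image r).image Prod.fst).card ≤ p := by
    refine (Finset.card_le_univ _).trans ?_
    rw [ZMod.card]
  calc T.card ≤ D * (T.image r).card := h1
    _ ≤ D * (G * ((T.image r).image Prod.fst).card) := Nat.mul_le_mul_left _ h2
    _ ≤ _ := by gcongr

theorem avg_count (g : BP ℤ) (B D N G K Xm : ℕ) (hG : g.totalDegree ≤ G) (Ps : Finset ℕ)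
    (hPs : ∀ p ∈ Ps, p.Prime ∧ p ≤ Xm ∧
      D.factorial * N ^ (∑ i ∈ Finset.range D, (i / B + i % B)) < p ^ (D * (D - 1) / 2))
    (hK : 2 * K ≤ Ps.card) (hP0 : 0 < Ps.card) (T : Finset (ℤ × ℤ))
    (hT : ∀ z ∈ T, ev z.1 z.2 g = 0 ∧ ev z.1 z.2 (Wr g B D * pderiv 1 g) ≠ 0 ∧
      |ev z.1 z.2 (Wr g B D * pderiv 1 g)| < 2 ^ K ∧ |z.1| ≤ N ∧ |z.2| ≤ N) :
    T.card ≤ 2 * (D * (G * Xm)) := by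
  classical
  set Zf : ℤ × ℤ → ℤ := fun z => ev z.1 z.2 (Wr g B D * pderiv 1 g) with hZ
  have hbad : ∀ z ∈ T, (Ps.filter fun p : ℕ => (p : ℤ) ∣ Zf z).card ≤ K := by
    intro z hz
    obtain ⟨-, h0, h1, -⟩ := hT z hz
    set F := Ps.filter fun p : ℕ => (p : ℤ) ∣ Zf z with hF
    have h2 : ∏ p ∈ F, p ∣ (Zf z).natAbs := by
      apply Finset.prod_primes_dvd
      · intro p hp
        exact (hPs p (Finset.mem_filter.mp hp).1).1.prime
      · intro p hp
        exact Int.natCast_dvd.mp (Finset.mem_filter.mp hp).2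
    have h3 : 2 ^ F.card ≤ ∏ p ∈ F, p := by
      rw [← Finset.prod_const]
      exact Finset.prod_le_prod' fun p hp => (hPs p (Finset.mem_filter.mp hp).1).1.two_le
    have h4 := Nat.le_of_dvd (Int.natAbs_pos.mpr h0) h2
    have h5 : (Zf z).natAbs < 2 ^ K := by
      have := h1
      rw [Int.abs_eq_natAbs] at this
      exact_mod_cast this
    exact ((Nat.pow_lt_pow_iff_right (by norm_num)).mp (h3.trans_lt (h4.trans_lt h5))).le
  have hsum : ∑ p ∈ Ps, (T.filter fun z => ¬ (p : ℤ) ∣ Zf z).card =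
      ∑ z ∈ T, (Ps.filter fun p : ℕ => ¬ (p : ℤ) ∣ Zf z).card := by
    simp only [Finset.card_filter]
    exact Finset.sum_comm
  have hge : T.card * Ps.card ≤ ∑ p ∈ Ps, 2 * (T.filter fun z => ¬ (p : ℤ) ∣ Zf z).card := by
    rw [← Finset.mul_sum, hsum, Finset.mul_sum, ← smul_eq_mul, ← Finset.sum_const]
    refine Finset.sum_le_sum fun z hz => ?_
    have h1 := Finset.card_filter_add_card_filter_not (s := Ps) (fun p : ℕ => (p : ℤ) ∣ Zf z)
    have h2 := hbad z hz
    omega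
  obtain ⟨p, hp, hle⟩ : ∃ p ∈ Ps, T.card ≤ 2 * (T.filter fun z => ¬ (p : ℤ) ∣ Zf z).card := by
    refine Finset.exists_le_of_sum_le (Finset.card_pos.mp hP0) ?_
    rw [Finset.sum_const, smul_eq_mul, mul_comm]
    exact hge
  obtain ⟨hpp, hpX, hpc⟩ := hPs p hp
  have : Fact p.Prime := ⟨hpp⟩
  have := good_count p g B D N G hG hpc (T.filter fun z => ¬ (p : ℤ) ∣ Zf z) (by
    intro z hz
    obtain ⟨hz1, hz2⟩ := Finset.mem_filter.mp hz
    obtain ⟨h1, h2, h3, h4, h5⟩ := hT z hz1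
    refine ⟨h1, fun h => hz2 ?_, fun h => hz2 ?_, h4, h5⟩
    · rw [hZ]; simp only [map_mul]; exact Dvd.dvd.mul_left h _
    · rw [hZ]; simp only [map_mul]; exact Dvd.dvd.mul_right h _)
  calc T.card ≤ _ := hle
    _ ≤ 2 * (D * (G * p)) := by omega
    _ ≤ _ := by gcongr


/-- The sum of the absolute values of the coefficients. -/
noncomputable def l1 (q : BP ℤ) : ℕ := ∑ m ∈ q.support, (coeff m q).natAbs

lemma l1_eq (q : BP ℤ) (s : Finset (Fin 2 →₀ ℕ)) (hs : q.support ⊆ s) :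
    l1 q = ∑ m ∈ s, (coeff m q).natAbs := by
  refine Finset.sum_subset hs fun m _ hm => ?_
  rw [notMem_support_iff.mp hm]; rfl

lemma l1_add (q r : BP ℤ) : l1 (q + r) ≤ l1 q + l1 r := by
  classical
  rw [l1_eq (q + r) (q.support ∪ r.support) support_add, l1_eq q _ Finset.subset_union_left,
    l1_eq r _ Finset.subset_union_right, ← Finset.sum_add_distrib]
  refine Finset.sum_le_sum fun m _ => ?_
  rw [coeff_add]
  exact Int.natAbs_add_le _ _

@[simp] lemma l1_zero : l1 0 = 0 := by simp [l1]

lemma l1_neg (q : BP ℤ) : l1 (-q) = l1 q := by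
  simp [l1]

lemma l1_sum {ι : Type} (s : Finset ι) (f : ι → BP ℤ) : l1 (∑ i ∈ s, f i) ≤ ∑ i ∈ s, l1 (f i) := by
  classical
  induction s using Finset.induction_on with
  | empty => simp
  | insert a s ha ih =>
    rw [Finset.sum_insert ha, Finset.sum_insert ha]
    exact (l1_add _ _).trans (by omega)

lemma l1_monomial (m : Fin 2 →₀ ℕ) (c : ℤ) : l1 (monomial m c) ≤ c.natAbs := by
  rw [l1_eq _ {m} support_monomial_subset]
  simp

lemma l1_mul (q r : BP ℤ) : l1 (q * r) ≤ l1 q * l1 r := by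
  conv_lhs => rw [← support_sum_monomial_coeff q, ← support_sum_monomial_coeff r, Finset.sum_mul_sum]
  refine (l1_sum _ _).trans ?_
  rw [l1, l1, Finset.sum_mul_sum]
  refine Finset.sum_le_sum fun m _ => (l1_sum _ _).trans (Finset.sum_le_sum fun n _ => ?_)
  rw [monomial_mul, ← Int.natAbs_mul]
  exact l1_monomial _ _

lemma le_tdeg (q : BP ℤ) (m : Fin 2 →₀ ℕ) (hm : m ∈ q.support) : m 0 + m 1 ≤ q.totalDegree := by
  have := le_totalDegree hm
  rwa [Finsupp.sum_fintype _ _ (fun _ => rfl), Fin.sum_univ_two] at this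

lemma l1_pderiv (q : BP ℤ) (i : Fin 2) : l1 (pderiv i q) ≤ q.totalDegree * l1 q := by
  conv_lhs => rw [← support_sum_monomial_coeff q, map_sum]
  refine (l1_sum _ _).trans ?_
  rw [l1, Finset.mul_sum]
  refine Finset.sum_le_sum fun m hm => ?_
  rw [pderiv_monomial]
  refine (l1_monomial _ _).trans ?_
  rw [Int.natAbs_mul, mul_comm]
  refine Nat.mul_le_mul_right _ ?_
  have := le_tdeg q m hm
  rcases fin2_cases i with rfl | rfl <;> simp <;> omega

lemma tdeg_pderiv {R : Type} [CommRing R] (q : BP R) (i : Fin 2) : (pderiv i q).totalDegree ≤ q.totalDegree := by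
  conv_lhs => rw [← support_sum_monomial_coeff q, map_sum]
  refine (totalDegree_finsetSum _ _).trans ?_
  refine Finset.sup_le fun m hm => ?_
  rw [pderiv_monomial]
  refine (totalDegree_monomial_le _ _).trans ?_
  refine le_trans ?_ (le_totalDegree hm)
  rw [Finsupp.sum_fintype _ _ (fun _ => rfl), Finsupp.sum_fintype _ _ (fun _ => rfl)]
  refine Finset.sum_le_sum fun j _ => ?_
  simp

lemma ev_bound (q : BP ℤ) (N : ℕ) (hN : 1 ≤ N) (x y : ℤ) (hx : |x| ≤ N) (hy : |y| ≤ N) (k : ℕ)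
    (hk : q.totalDegree ≤ k) : |ev x y q| ≤ (l1 q : ℤ) * (N : ℤ) ^ k := by
  rw [ev, aeval_def, eval₂_eq', l1]
  refine (Finset.abs_sum_le_sum_abs _ _).trans ?_
  push_cast
  rw [Finset.sum_mul]
  refine Finset.sum_le_sum fun m hm => ?_
  rw [abs_mul, Fin.prod_univ_two]
  have h1 : |(algebraMap ℤ ℤ) (coeff m q)| = |coeff m q| := rfl
  rw [h1]
  refine mul_le_mul_of_nonneg_left ?_ (abs_nonneg _)
  have hN' : (1 : ℤ) ≤ N := by exact_mod_cast hN
  calc |x ^ m 0 * y ^ m 1| = |x| ^ m 0 * |y| ^ m 1 := by rw [abs_mul, abs_pow, abs_pow]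
    _ ≤ (N:ℤ) ^ m 0 * (N:ℤ) ^ m 1 := by gcongr
    _ = (N:ℤ) ^ (m 0 + m 1) := (pow_add _ _ _).symm
    _ ≤ _ := pow_le_pow_right₀ hN' ((le_tdeg q m hm).trans hk)

/-- Degree and size bound. -/
def Bd (q : BP ℤ) (k L : ℕ) : Prop := q.totalDegree ≤ k ∧ l1 q ≤ L

lemma Bd.mono {q : BP ℤ} {k L k' L' : ℕ} (h : Bd q k L) (hk : k ≤ k') (hL : L ≤ L') : Bd q k' L' :=
  ⟨h.1.trans hk, h.2.trans hL⟩

lemma Bd.mul {q r : BP ℤ} {k L k' L' : ℕ} (h : Bd q k L) (h' : Bd r k' L') : Bd (q * r) (k+k') (L*L') :=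
  ⟨(totalDegree_mul _ _).trans (Nat.add_le_add h.1 h'.1), (l1_mul _ _).trans (Nat.mul_le_mul h.2 h'.2)⟩

lemma Bd.sub {q r : BP ℤ} {k L L' : ℕ} (h : Bd q k L) (h' : Bd r k L') : Bd (q - r) k (L+L') :=
  ⟨(totalDegree_sub _ _).trans (max_le h.1 h'.1), by
    rw [sub_eq_add_neg]
    refine (l1_add _ _).trans ?_
    rw [l1_neg]
    exact Nat.add_le_add h.2 h'.2⟩

lemma Bd.pd {q : BP ℤ} {k L : ℕ} (h : Bd q k L) (i : Fin 2) : Bd (pderiv i q) k (k*L) :=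
  ⟨(tdeg_pderiv _ _).trans h.1, (l1_pderiv _ _).trans (Nat.mul_le_mul h.1 h.2)⟩

lemma Bd.dl {g q : BP ℤ} {G L k M : ℕ} (hg : Bd g G L) (hq : Bd q k M) :
    Bd (dl g q) (G + k) (2 * G * L * k * M) := by
  rw [dl_apply]
  refine (((hg.pd 1).mul (hq.pd 0)).sub ((hg.pd 0).mul (hq.pd 1))).mono le_rfl (le_of_eq ?_)
  ring

lemma Bd.phi (B i : ℕ) : Bd (phi B i) (i / B + i % B) 1 := by
  rw [phi_eq]
  refine ⟨(totalDegree_monomial_le _ _).trans ?_, (l1_monomial _ _).trans (by simp)⟩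
  rw [Finsupp.sum_fintype _ _ (fun _ => rfl)]
  simp

lemma Bd.prod {ι : Type} (s : Finset ι) (f : ι → BP ℤ) (k L : ℕ) (h : ∀ i ∈ s, Bd (f i) k L) :
    Bd (∏ i ∈ s, f i) (s.card * k) (L ^ s.card) := by
  classical
  induction s using Finset.induction_on with
  | empty => 
    refine ⟨by simp, ?_⟩
    have := l1_monomial 0 1
    simpa using this
  | insert a s ha ih =>
    rw [Finset.prod_insert ha, Finset.card_insert_of_notMem ha]
    refine ((h a (Finset.mem_insert_self _ _)).mul (ih fun i hi => h i (Finset.mem_insert_of_mem hi))).mono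
      (le_of_eq (by ring)) (le_of_eq (by ring))

lemma Bd.det (D k L : ℕ) (M : Matrix (Fin D) (Fin D) (BP ℤ)) (h : ∀ i j, Bd (M i j) k L) :
    Bd M.det (D * k) (D.factorial * L ^ D) := by
  rw [Matrix.det_apply]
  have h1 : ∀ σ : Equiv.Perm (Fin D), Bd (Equiv.Perm.sign σ • ∏ i, M (σ i) i) (D * k) (L ^ D) := by
    intro σ
    have h2 := Bd.prod Finset.univ (fun i => M (σ i) i) k L (fun i _ => h _ _)
    rw [Finset.card_univ, Fintype.card_fin] at h2
    rcases Int.units_eq_one_or (Equiv.Perm.sign σ) with h | h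
    · rw [h, one_smul]; exact h2
    · rw [h, Units.neg_smul, one_smul]
      exact ⟨by rw [totalDegree_neg]; exact h2.1, by rw [l1_neg]; exact h2.2⟩
  refine ⟨(totalDegree_finsetSum _ _).trans (Finset.sup_le fun σ _ => (h1 σ).1), (l1_sum _ _).trans ?_⟩
  refine (Finset.sum_le_sum fun σ _ => (h1 σ).2).trans ?_
  rw [Finset.sum_const, Finset.card_univ, Fintype.card_perm, Fintype.card_fin, smul_eq_mul]

lemma Bd.Wr {g : BP ℤ} {G L : ℕ} (hg : Bd g G L) (hG : 1 ≤ G) (hL : 1 ≤ L) (B D : ℕ) :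
    Bd (Wr g B D) (D * (D * (G + 1))) (D.factorial * (2 * G * L * (D * (G + 1))) ^ (D * D)) := by
  set E := D * (G + 1) with hE
  set c := 2 * G * L * E with hc
  rw [_root_.Wr, pow_mul]
  refine Bd.det D E (c ^ D) _ fun i j => ?_
  have hDE : D ≤ E := Nat.le_mul_of_pos_right _ (by omega)
  have hi := i.2
  have hc1 : 1 ≤ c := Nat.one_le_iff_ne_zero.mpr (by
    have : 0 < E := by omega
    positivity)
  have key : ∀ j : ℕ, j ≤ D → Bd (((_root_.dl g)^[j]) (_root_.phi B i)) (D + j * G) (c ^ j) := by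
    intro j
    induction j with
    | zero =>
      intro _
      refine (Bd.phi B i).mono ?_ (by simp)
      have h1 := Nat.div_add_mod (i : ℕ) B
      rcases Nat.eq_zero_or_pos B with rfl | hB
      · simp
      · have : (i : ℕ) / B ≤ B * (i / B) := Nat.le_mul_of_pos_left _ hB
        omega
    | succ j ih =>
      intro hj
      rw [Function.iterate_succ_apply']
      refine (hg.dl (ih (by omega))).mono (le_of_eq (by ring)) ?_
      rw [pow_succ, mul_comm (c ^ j)]
      refine Nat.mul_le_mul_right _ ?_
      rw [hc]
      refine Nat.mul_le_mul_left _ ?_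
      rw [hE]
      have : j * G ≤ D * G := Nat.mul_le_mul_right _ (by omega)
      rw [mul_add, mul_one]; omega
  refine (key j j.2.le).mono ?_ (pow_le_pow_right₀ hc1 j.2.le)
  have : j * G ≤ D * G := Nat.mul_le_mul_right _ j.2.le
  rw [hE, mul_add, mul_one]; omega

lemma Bd.Z {g : BP ℤ} {G L : ℕ} (hg : Bd g G L) (hG : 1 ≤ G) (hL : 1 ≤ L) (B D : ℕ) :
    Bd (_root_.Wr g B D * pderiv 1 g) (D * (D * (G + 1)) + G)
      (D.factorial * (2 * G * L * (D * (G + 1))) ^ (D * D) * (G * L)) :=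
  (hg.Wr hG hL B D).mul (hg.pd 1)

lemma Bd.ev {q : BP ℤ} {k L : ℕ} (h : Bd q k L) (N : ℕ) (hN : 1 ≤ N) (x y : ℤ) (hx : |x| ≤ N) (hy : |y| ≤ N) :
    |ev x y q| ≤ (L : ℤ) * (N : ℤ) ^ k := by
  refine (ev_bound q N hN x y hx hy k h.1).trans ?_
  have := h.2
  gcongr


section siegel
attribute [local instance] Matrix.seminormedAddCommGroup

theorem siegel_poly (d N : ℕ) (hd : 1 ≤ d) (hN : 1 ≤ N) (T : Finset (ℤ × ℤ)) (hT : T.card = 8 * d ^ 2 + 1)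
    (hb : ∀ z ∈ T, |z.1| ≤ N ∧ |z.2| ≤ N) :
    ∃ g : BP ℤ, g ≠ 0 ∧ (∀ z ∈ T, ev z.1 z.2 g = 0) ∧
      Bd g (8 * d) ((4 * d + 1) ^ 4 * N ^ (8 * d)) := by
  classical
  let A : Matrix T (Fin (4*d+1) × Fin (4*d+1)) ℤ := Matrix.of fun z ij =>
    z.1.1 ^ (ij.1 : ℕ) * z.1.2 ^ (ij.2 : ℕ)
  have hA : ‖A‖ ≤ (N : ℝ) ^ (8 * d) := by
    rw [Matrix.norm_le_iff (by positivity)]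
    intro z ij
    have h1 := hb z.1 z.2
    have hN' : (1 : ℤ) ≤ N := by exact_mod_cast hN
    have : |A z ij| ≤ (N : ℤ) ^ (8 * d) := by
      calc |A z ij| = |z.1.1| ^ (ij.1 : ℕ) * |z.1.2| ^ (ij.2 : ℕ) := by
            simp only [A, Matrix.of_apply]; rw [abs_mul, abs_pow, abs_pow]
        _ ≤ (N : ℤ) ^ (ij.1 : ℕ) * (N : ℤ) ^ (ij.2 : ℕ) := by gcongr; exacts [h1.1, h1.2]
        _ = (N : ℤ) ^ ((ij.1 : ℕ) + ij.2) := (pow_add _ _ _).symm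
        _ ≤ _ := pow_le_pow_right₀ hN' (by have := ij.1.2; have := ij.2.2; omega)
    rw [Int.norm_eq_abs]
    exact_mod_cast this
  have hcT : Fintype.card T = 8 * d ^ 2 + 1 := by rw [Fintype.card_coe, hT]
  have hcU : Fintype.card (Fin (4*d+1) × Fin (4*d+1)) = (4*d+1)^2 := by simp [sq]
  obtain ⟨t, ht0, htA, htn⟩ := Int.Matrix.exists_ne_zero_int_vec_norm_le A
    (by rw [hcT, hcU]; nlinarith) (by rw [hcT]; omega)
  have htb : ∀ ij, (t ij).natAbs ≤ (4*d+1)^2 * N ^ (8 * d) := by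
    intro ij
    have h1 : ‖t ij‖ ≤ ‖t‖ := norm_le_pi_norm t ij
    have hN1 : (1 : ℝ) ≤ N := by exact_mod_cast hN
    have h2 : ((Fintype.card (Fin (4*d+1) × Fin (4*d+1)) : ℝ) * max 1 ‖A‖) ^
        ((Fintype.card T : ℝ) / (Fintype.card (Fin (4*d+1) × Fin (4*d+1)) - Fintype.card T)) ≤
        (4*d+1)^2 * (N : ℝ) ^ (8 * d) := by
      have h3 : (1 : ℝ) ≤ (N : ℝ) ^ (8 * d) := one_le_pow₀ hN1
      have h4 : (Fintype.card (Fin (4*d+1) × Fin (4*d+1)) : ℝ) = (4*d+1)^2 := by rw [hcU]; push_cast; ring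
      have h5 : (Fintype.card T : ℝ) = 8 * d^2 + 1 := by rw [hcT]; push_cast; ring
      have hd' : (1 : ℝ) ≤ d := by exact_mod_cast hd
      rw [h4, h5]
      have h6 : (1 : ℝ) ≤ (4*d+1)^2 * max 1 ‖A‖ := by
        have : (1 : ℝ) ≤ max 1 ‖A‖ := le_max_left _ _
        nlinarith
      refine (Real.rpow_le_rpow_of_exponent_le h6 (y := _) (z := 1) ?_).trans ?_
      · rw [div_le_one (by nlinarith)]; nlinarith
      · rw [Real.rpow_one]
        gcongr
        exact max_le h3 hA
    have h3 := h1.trans (htn.trans h2)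
    rw [Int.norm_eq_abs] at h3
    have h4 : ((t ij).natAbs : ℝ) = |(t ij : ℝ)| := by rw [Nat.cast_natAbs]; push_cast; rfl
    rw [← h4] at h3
    exact_mod_cast h3
  let e : Fin (4*d+1) × Fin (4*d+1) → (Fin 2 →₀ ℕ) := fun ij =>
    Finsupp.single 0 (ij.1 : ℕ) + Finsupp.single 1 (ij.2 : ℕ)
  have he : Function.Injective e := by
    intro a b hab
    have h0 := DFunLike.congr_fun hab 0
    have h1 := DFunLike.congr_fun hab 1
    simp [e] at h0 h1
    exact Prod.ext (Fin.ext h0) (Fin.ext h1)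
  refine ⟨∑ ij, monomial (e ij) (t ij), ?_, ?_, ?_, ?_⟩
  · obtain ⟨ij, hij⟩ := Function.ne_iff.mp ht0
    intro h0
    apply hij
    have := congrArg (coeff (e ij)) h0
    rw [coeff_sum] at this
    simpa [coeff_monomial, he.eq_iff] using this
  · intro z hz
    have := congrFun htA ⟨z, hz⟩
    rw [map_sum, ← show (0 : T → ℤ) ⟨z, hz⟩ = 0 from rfl, ← this]
    simp only [Matrix.mulVec, dotProduct, A, Matrix.of_apply]
    refine Finset.sum_congr rfl fun ij _ => ?_
    rw [ev, aeval_monomial, Finsupp.prod_fintype _ _ (fun _ => pow_zero _), Fin.prod_univ_two]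
    simp [e, mul_comm]
  · refine (totalDegree_finsetSum _ _).trans (Finset.sup_le fun ij _ => ?_)
    refine (totalDegree_monomial_le _ _).trans ?_
    rw [Finsupp.sum_fintype _ _ (fun _ => rfl), Fin.sum_univ_two]
    have := ij.1.2
    have := ij.2.2
    simp [e]
    omega
  · refine (l1_sum _ _).trans ((Finset.sum_le_sum fun ij _ => (l1_monomial _ _).trans (htb ij)).trans ?_)
    rw [Finset.sum_const, Finset.card_univ, hcU, smul_eq_mul]
    exact le_of_eq (by ring)
end siegel

/-- Reduction to the complex numbers. -/
noncomputable abbrev toC (q : BP ℤ) : BP ℂ := map (Int.castRingHom ℂ) q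

lemma eval_toC (q : BP ℤ) (z : ℤ × ℤ) : eval ![(z.1 : ℂ), (z.2 : ℂ)] (toC q) = ((ev z.1 z.2 q : ℤ) : ℂ) := by
  have h1 := ev_map (Int.castRingHom ℂ) z.1 z.2 q
  simp only [Int.coe_castRingHom] at h1
  rw [h1, toC, eval_map, ev, aeval_def]
  rfl

lemma tdeg_toC (q : BP ℤ) : (toC q).totalDegree ≤ q.totalDegree := by
  rw [totalDegree, totalDegree]
  exact Finset.sup_mono (support_map_subset _ _)

lemma bezout_int (f : BP ℂ) (hf : Irreducible f) (q : BP ℤ) (hq : ¬ f ∣ toC q) (T : Finset (ℤ × ℤ))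
    (hT : ∀ z ∈ T, eval ![(z.1 : ℂ), (z.2 : ℂ)] f = 0 ∧ ev z.1 z.2 q = 0) (k : ℕ) (hk : q.totalDegree ≤ k) :
    T.card ≤ f.totalDegree * k := by
  classical
  have h := bezout f (toC q) hf hq (T.image fun z => ![(z.1 : ℂ), (z.2 : ℂ)]) (by
    intro w hw
    obtain ⟨z, hz, rfl⟩ := Finset.mem_image.mp hw
    refine ⟨(hT z hz).1, ?_⟩
    rw [eval_toC, (hT z hz).2, Int.cast_zero])
  rw [Finset.card_image_of_injective] at h
  · exact h.trans (Nat.mul_le_mul_left _ ((tdeg_toC q).trans hk))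
  · intro z w hzw
    have h0 := congrFun hzw 0
    have h1 := congrFun hzw 1
    simp at h0 h1
    exact Prod.ext h0 h1

lemma degreeOf_pd (q : BP ℤ) : degreeOf 1 (pderiv 1 q) ≤ degreeOf 1 q - 1 := by
  rw [degreeOf_le_iff]
  intro m hm
  rw [mem_support_iff, coeff_pderiv] at hm
  have h1 : m + Finsupp.single 1 1 ∈ q.support := by
    rw [mem_support_iff]; exact left_ne_zero_of_mul hm
  have h2 := monomial_le_degreeOf 1 h1
  simp at h2
  omega

lemma pd_ne_zero (q : BP ℤ) (h : 0 < degreeOf 1 q) : pderiv 1 q ≠ 0 := by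
  intro h0
  have h1 : degreeOf 1 q ≤ 0 := by
    rw [degreeOf_le_iff]
    intro m hm
    by_contra hcon
    have h2 := coeff_pderiv (i := 1) q (m - Finsupp.single 1 1)
    have h3 : m - Finsupp.single 1 1 + Finsupp.single 1 1 = m := by
      ext j
      rcases fin2_cases j with rfl | rfl <;> simp
      omega
    rw [h0, coeff_zero, h3] at h2
    have h4 := mul_ne_zero (mem_support_iff.mp hm)
      (show (((m - Finsupp.single 1 1 : Fin 2 →₀ ℕ) 1 : ℤ) + 1) ≠ 0 by positivity)
    exact h4 h2.symm
  omega

theorem make_sep (f : BP ℂ) (hf1 : 0 < degreeOf 1 f) (G : ℕ) (hG : 1 ≤ G) (k : ℕ) :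
    ∀ (g : BP ℤ) (L : ℕ), g ≠ 0 → f ∣ toC g → degreeOf 1 g ≤ k → Bd g G L →
      ∃ g' : BP ℤ, f ∣ toC g' ∧ ¬ f ∣ toC (pderiv 1 g') ∧ Bd g' G (G ^ k * L) := by
  have hdeg : ∀ g : BP ℤ, g ≠ 0 → f ∣ toC g → 0 < degreeOf 1 g := by
    intro g hg0 hfg
    obtain ⟨h, hh⟩ := hfg
    have hinj := map_injective (σ := Fin 2) (Int.castRingHom ℂ) Int.cast_injective
    have hne : toC g ≠ 0 := by
      intro h0; apply hg0; apply hinj; simpa using h0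
    have h1 : degreeOf 1 (toC g) = degreeOf 1 f + degreeOf 1 h := by
      rw [hh]; exact degreeOf_mul_eq (by rintro rfl; simp [hh] at hne) (by rintro rfl; simp [hh] at hne)
    have h2 : degreeOf 1 (toC g) ≤ degreeOf 1 g := by
      rw [degreeOf_eq_sup, degreeOf_eq_sup]
      exact Finset.sup_mono (support_map_subset _ _)
    omega
  induction k with
  | zero =>
    intro g L hg0 hfg hk _
    have := hdeg g hg0 hfg
    omega
  | succ k ih =>
    intro g L hg0 hfg hk hB
    by_cases hs : f ∣ toC (pderiv 1 g)
    · obtain ⟨g', h1, h2, h3⟩ := ih (pderiv 1 g) (G * L) (pd_ne_zero g (hdeg g hg0 hfg)) hs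
        ((degreeOf_pd g).trans (by omega)) (hB.pd 1)
      exact ⟨g', h1, h2, h3.mono le_rfl (le_of_eq (by ring))⟩
    · exact ⟨g, hfg, hs, hB.mono le_rfl (Nat.le_mul_of_pos_left _ (by positivity))⟩


lemma size_bound (d A B N : ℕ) (hd : 1 ≤ d) (hA : 1 ≤ A) (hB : 1 ≤ B) (hBA : B ≤ A)
    (hdA : d ≤ 2 ^ A) (hN : N ≤ 2 ^ A) :
    (A*B).factorial * (2 * (8*d) * ((8*d)^(8*d) * ((4*d+1)^4 * N^(8*d))) * ((A*B) * (8*d+1))) ^ ((A*B)*(A*B))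
      * ((8*d) * ((8*d)^(8*d) * ((4*d+1)^4 * N^(8*d)))) * N ^ ((A*B)*((A*B)*(8*d+1)) + 8*d)
      < 2 ^ (200 * d * A ^ 5) := by
  set D := A * B with hD
  have hD1 : 1 ≤ D := Nat.mul_pos hA hB
  have h16 : (16 : ℕ) * 2 ^ A ≤ 2 ^ (5 * A) := by
    rw [show (16 : ℕ) = 2 ^ 4 by norm_num, ← pow_add]
    exact Nat.pow_le_pow_right (by norm_num) (by omega)
  have h2A : 1 ≤ 2 ^ A := Nat.one_le_two_pow
  have hG : 8 * d ≤ 2 ^ (5 * A) := by omega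
  have hG1 : 8 * d + 1 ≤ 2 ^ (5 * A) := by omega
  have h4 : 4 * d + 1 ≤ 2 ^ (5 * A) := by omega
  have hAA : A ≤ 2 ^ A := Nat.lt_two_pow_self.le
  have hD2 : D ≤ 2 ^ (2 * A) := by
    calc D = A * B := rfl
      _ ≤ 2 ^ A * 2 ^ A := Nat.mul_le_mul hAA (hBA.trans hAA)
      _ = _ := by rw [← pow_add]; congr 1; ring
  have hdA1 : A ≤ d * A := Nat.le_mul_of_pos_left _ hd
  have hL : (8*d)^(8*d) * ((4*d+1)^4 * N^(8*d)) ≤ 2 ^ (68 * (d * A)) := by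
    calc _ ≤ (2 ^ (5*A))^(8*d) * ((2^(5*A))^4 * (2^A)^(8*d)) := by gcongr
      _ = 2 ^ (5*A*(8*d) + (5*A*4 + A*(8*d))) := by rw [← pow_mul, ← pow_mul, ← pow_mul, ← pow_add, ← pow_add]
      _ ≤ _ := Nat.pow_le_pow_right (by norm_num) (by nlinarith)
  set L := (8*d)^(8*d) * ((4*d+1)^4 * N^(8*d)) with hLd
  have hc : 2 * (8*d) * L * (D * (8*d+1)) ≤ 2 ^ (81 * (d * A)) := by
    calc _ ≤ 2 ^ A * 2 ^ (5*A) * 2 ^ (68 * (d*A)) * (2 ^ (2*A) * 2 ^ (5*A)) := by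
          gcongr
          calc 2 = 2 ^ 1 := rfl
            _ ≤ _ := Nat.pow_le_pow_right (by norm_num) hA
      _ = 2 ^ (A + 5*A + 68 * (d*A) + (2*A + 5*A)) := by rw [← pow_add, ← pow_add, ← pow_add, ← pow_add]
      _ ≤ _ := Nat.pow_le_pow_right (by norm_num) (by omega)
  set c := 2 * (8*d) * L * (D * (8*d+1)) with hcd
  have hf : D.factorial ≤ 2 ^ (2 * A * D) := by
    rw [pow_mul]
    exact (Nat.factorial_le_pow D).trans (Nat.pow_le_pow_left hD2 _)
  have hDA : D ≤ A ^ 2 := by rw [sq]; exact Nat.mul_le_mul_left _ hBA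
  have hDD : D * D ≤ A ^ 4 := by
    calc D * D ≤ A^2 * A^2 := Nat.mul_le_mul hDA hDA
      _ = _ := by ring
  calc _ ≤ 2 ^ (2 * A * D) * (2 ^ (81 * (d * A))) ^ (D * D) * (2 ^ (5*A) * 2 ^ (68 * (d*A))) *
        (2 ^ A) ^ (D * (D * (8*d+1)) + 8*d) := by gcongr
    _ = 2 ^ (2 * A * D + 81 * (d*A) * (D * D) + (5*A + 68 * (d*A)) + A * (D * (D * (8*d+1)) + 8*d)) := by
        rw [← pow_mul, ← pow_mul, ← pow_add, ← pow_add, ← pow_add, ← pow_add]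
    _ < _ := by
        apply Nat.pow_lt_pow_right (by norm_num)
        have e1 : A * D ≤ d * A * (D * D) := by
          have : D ≤ D * D := Nat.le_mul_of_pos_left _ hD1
          exact Nat.mul_le_mul hdA1 this
        have e2 : d * A ≤ d * A * (D * D) := Nat.le_mul_of_pos_right _ (Nat.mul_pos hD1 hD1)
        have e3 : A * (D * (D * (8*d+1)) + 8*d) = 8 * (d*A*(D*D)) + A*(D*D) + 8 * (d*A) := by ring
        have e4 : A * (D*D) ≤ d*A*(D*D) := Nat.mul_le_mul_right _ hdA1
        have e5 : d * A * (D * D) ≤ d * A ^ 5 := by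
          calc _ ≤ d * A * A^4 := Nat.mul_le_mul_left _ hDD
            _ = _ := by ring
        have e6 : 1 ≤ d * A ^ 5 := Nat.mul_pos hd (by positivity)
        have e7 : 2 * A * D = 2 * (A * D) := by ring
        have e8 : 81 * (d*A) * (D*D) = 81 * (d*A*(D*D)) := by ring
        have e9 : 200 * d * A^5 = 200 * (d*A^5) := by ring
        rw [e3, e7, e8, e9]
        omega

theorem core (f : BP ℂ) (hf : Irreducible f) (d : ℕ) (hfd : f.totalDegree = d) (hd : 1 ≤ d)
    (hf1 : degreeOf 1 f = d) (A B N Xm : ℕ) (hA : 1 ≤ A) (hB : 1 ≤ B) (hBA : B ≤ A) (hBd : B ≤ d)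
    (hdA : d ≤ 2 ^ A) (hN : N ≤ 2 ^ A) (hN1 : 1 ≤ N) (Ps : Finset ℕ)
    (hPs : ∀ p ∈ Ps, p.Prime ∧ p ≤ Xm ∧
      (A*B).factorial * N ^ (∑ i ∈ Finset.range (A*B), (i / B + i % B)) < p ^ ((A*B) * (A*B - 1) / 2))
    (hK : 2 * (200 * d * A ^ 5) ≤ Ps.card) (T : Finset (ℤ × ℤ))
    (hT : ∀ z ∈ T, eval ![(z.1 : ℂ), (z.2 : ℂ)] f = 0 ∧ |z.1| ≤ N ∧ |z.2| ≤ N) :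
    T.card ≤ 8 * d ^ 2 + d * ((A*B) * ((A*B) * (8*d+1)) + 8*d) + 2 * ((A*B) * (8*d*Xm)) := by
  classical
  by_cases hsmall : T.card ≤ 8 * d ^ 2
  · omega
  push Not at hsmall
  obtain ⟨T0, hT0, hT0c⟩ := Finset.exists_subset_card_eq (show 8 * d ^ 2 + 1 ≤ T.card by omega)
  obtain ⟨g0, hg00, hg0z, hg0B⟩ := siegel_poly d N hd hN1 T0 hT0c fun z hz => (hT z (hT0 hz)).2
  have hfg0 : f ∣ toC g0 := by
    by_contra hcon
    have := bezout_int f hf g0 hcon T0 (fun z hz => ⟨(hT z (hT0 hz)).1, hg0z z hz⟩) (8*d) hg0B.1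
    rw [hT0c, hfd] at this
    nlinarith
  obtain ⟨g, hfg, hfgy, hgB⟩ := make_sep f (by omega) (8*d) (by omega) (8*d) g0 _ hg00 hfg0
    ((degreeOf_le_totalDegree _ _).trans hg0B.1) hg0B
  set D := A * B with hD
  have hW : ¬ f ∣ toC (Wr g B D * pderiv 1 g) := by
    rw [toC, map_mul, hf.prime.dvd_mul, map_Wr, not_or]
    obtain ⟨h, hh⟩ := hfg
    refine ⟨not_dvd_Wr f h _ hf hh ?_ (by omega) B D hB (by omega), hfgy⟩
    rw [pderiv_map]; exact hfgy
  have hgz : ∀ z ∈ T, ev z.1 z.2 g = 0 := by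
    intro z hz
    obtain ⟨h, hh⟩ := hfg
    have h1 := eval_toC g z
    rw [hh, map_mul, (hT z hz).1, zero_mul] at h1
    exact_mod_cast h1.symm
  have hL1 : 1 ≤ (8*d)^(8*d) * ((4*d+1)^4 * N^(8*d)) := Nat.succ_le_of_lt (by positivity)
  have hZ := hgB.Z (by omega) hL1 B D
  have h1 := bezout_int f hf _ hW (T.filter fun z => ev z.1 z.2 (Wr g B D * pderiv 1 g) = 0)
    (fun z hz => ⟨(hT z (Finset.mem_filter.mp hz).1).1, (Finset.mem_filter.mp hz).2⟩) _ hZ.1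
  rw [hfd] at h1
  have hpos : 0 < d * A ^ 5 := by positivity
  have h2 := avg_count g B D N (8*d) (200 * d * A ^ 5) Xm hgB.1 Ps hPs hK (by nlinarith)
    (T.filter fun z => ¬ ev z.1 z.2 (Wr g B D * pderiv 1 g) = 0) (by
      intro z hz
      obtain ⟨hz1, hz2⟩ := Finset.mem_filter.mp hz
      obtain ⟨hz3, hz4, hz5⟩ := hT z hz1
      refine ⟨hgz z hz1, hz2, ?_, hz4, hz5⟩
      refine (hZ.ev N hN1 z.1 z.2 hz4 hz5).trans_lt ?_
      exact_mod_cast size_bound d A B N hd hA hB hBA hdA hN)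
  have h3 := Finset.card_filter_add_card_filter_not (s := T)
    (fun z => ev z.1 z.2 (Wr g B D * pderiv 1 g) = 0)
  omega


/-- The shear substitution. -/
noncomputable def shr (t : ℂ) : BP ℂ →ₐ[ℂ] BP ℂ := aeval ![X 0 + C t * X 1, X 1]

lemma shr_X0 (t : ℂ) : shr t (X 0) = X 0 + C t * X 1 := by simp [shr]
lemma shr_X1 (t : ℂ) : shr t (X 1) = X 1 := by simp [shr]
lemma shr_C (t a : ℂ) : shr t (C a) = C a := by simp [shr]

lemma shr_comp (s t : ℂ) (h : s + t = 0) : (shr s).comp (shr t) = AlgHom.id ℂ (BP ℂ) := by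
  apply MvPolynomial.algHom_ext
  intro i
  rcases fin2_cases i with rfl | rfl
  · simp only [AlgHom.comp_apply, shr_X0, map_add, map_mul, shr_C, shr_X1, AlgHom.id_apply]
    rw [add_assoc, ← add_mul, ← C_add, h]
    simp
  · simp only [AlgHom.comp_apply, shr_X1, AlgHom.id_apply]

lemma shr_irr (t : ℂ) (f : BP ℂ) (hf : Irreducible f) : Irreducible (shr t f) := by
  let e : BP ℂ ≃ₐ[ℂ] BP ℂ := AlgEquiv.ofAlgHom (shr t) (shr (-t)) (shr_comp _ _ (by ring)) (shr_comp _ _ (by ring))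
  exact (MulEquiv.irreducible_iff e).mpr hf

lemma shr_eval (t : ℂ) (f : BP ℂ) (x y : ℂ) : eval ![x - t * y, y] (shr t f) = eval ![x, y] f := by
  have : (eval ![x - t * y, y]).comp (shr t : BP ℂ →+* BP ℂ) = eval ![x, y] := by
    apply MvPolynomial.ringHom_ext
    · intro r
      simp [shr_C]
    · intro i
      rcases fin2_cases i with rfl | rfl
      · simp [shr_X0]
      · simp [shr_X1]
  exact DFunLike.congr_fun this f

lemma le_tdegC (q : BP ℂ) (m : Fin 2 →₀ ℕ) (hm : m ∈ q.support) : m 0 + m 1 ≤ q.totalDegree := by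
  have := le_totalDegree hm
  rwa [Finsupp.sum_fintype _ _ (fun _ => rfl), Fin.sum_univ_two] at this

lemma shr_tdeg (t : ℂ) (f : BP ℂ) : (shr t f).totalDegree ≤ f.totalDegree := by
  rw [shr, aeval_def, eval₂_eq']
  refine totalDegree_finsetSum_le fun m hm => ?_
  refine le_trans ?_ (le_tdegC f m hm)
  rw [Fin.prod_univ_two]
  have h1 : (X 0 + C t * X 1 : BP ℂ).totalDegree ≤ 1 := by
    refine (totalDegree_add _ _).trans (max_le (by rw [totalDegree_X]) ?_)
    refine (totalDegree_mul _ _).trans ?_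
    rw [totalDegree_C, totalDegree_X]
  have h2 : (X 1 : BP ℂ).totalDegree ≤ 1 := by rw [totalDegree_X]
  change (C (coeff m f) * ((X 0 + C t * X 1 : BP ℂ) ^ m 0 * (X 1 : BP ℂ) ^ m 1)).totalDegree ≤ _
  refine (totalDegree_mul _ _).trans ?_
  rw [totalDegree_C, zero_add]
  refine (totalDegree_mul _ _).trans (Nat.add_le_add ?_ ?_)
  · exact (totalDegree_pow _ _).trans (by nlinarith)
  · exact (totalDegree_pow _ _).trans (by nlinarith)

lemma natDegree_sub (q : BP ℂ) : (aeval ![(0 : Polynomial ℂ), Polynomial.X] q).natDegree ≤ degreeOf 1 q := by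
  rw [aeval_def, eval₂_eq']
  refine Polynomial.natDegree_sum_le_of_forall_le _ _ fun m hm => ?_
  refine le_trans ?_ (monomial_le_degreeOf 1 hm)
  rw [Fin.prod_univ_two]
  change (Polynomial.C (coeff m q) * ((0 : Polynomial ℂ) ^ m 0 * Polynomial.X ^ m 1)).natDegree ≤ _
  rcases Nat.eq_zero_or_pos (m 0) with h | h
  · rw [h, pow_zero, one_mul]; exact Polynomial.natDegree_C_mul_X_pow_le _ _
  · rw [zero_pow h.ne', zero_mul, mul_zero]; simp

theorem shear_exists (f : BP ℂ) (hf : Irreducible f) (d : ℕ) (hfd : f.totalDegree = d) (hd : 1 ≤ d) :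
    ∃ t : ℕ, t ≤ d ∧ Irreducible (shr t f) ∧ (shr t f).totalDegree = d ∧ degreeOf 1 (shr t f) = d := by
  classical
  set S := f.support.filter (fun m => m 0 + m 1 = d) with hS
  set h : Polynomial ℂ := ∑ m ∈ S, Polynomial.monomial (m 0) (coeff m f) with hh
  have hdeg : h.natDegree ≤ d := by
    refine Polynomial.natDegree_sum_le_of_forall_le _ _ fun m hm => ?_
    have := (Finset.mem_filter.mp hm).2
    exact (Polynomial.natDegree_monomial_le _).trans (by omega)
  have h0 : h ≠ 0 := by
    obtain ⟨m, hm, hmd⟩ := Finset.exists_mem_eq_sup f.support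
      (by rw [Finset.nonempty_iff_ne_empty, Ne, support_eq_empty]; exact hf.ne_zero)
      (fun s => s.sum fun _ e => e)
    have hmd' : m 0 + m 1 = d := by
      rw [← hfd, totalDegree, hmd, Finsupp.sum_fintype _ _ (fun _ => rfl), Fin.sum_univ_two]
    intro hz
    have h1 := congrArg (fun q => Polynomial.coeff q (m 0)) hz
    simp only [hh, Polynomial.finsetSum_coeff, Polynomial.coeff_monomial, Polynomial.coeff_zero] at h1
    rw [Finset.sum_eq_single_of_mem m (Finset.mem_filter.mpr ⟨hm, hmd'⟩)] at h1
    · simp at h1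
      exact (mem_support_iff.mp hm) h1
    · intro b hb hbm
      have hb2 := (Finset.mem_filter.mp hb).2
      rw [if_neg]
      intro hb0
      apply hbm
      ext i
      rcases fin2_cases i with rfl | rfl
      · exact hb0
      · omega
  obtain ⟨t, htd, ht⟩ : ∃ t : ℕ, t ≤ d ∧ h.eval (t : ℂ) ≠ 0 := by
    by_contra hcon
    push Not at hcon
    have h1 : ((Finset.range (d+1)).image (fun t : ℕ => (t : ℂ))) ⊆ h.roots.toFinset := by
      intro z hz
      obtain ⟨t, ht, rfl⟩ := Finset.mem_image.mp hz
      rw [Multiset.mem_toFinset, Polynomial.mem_roots h0]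
      exact hcon t (by have := Finset.mem_range.mp ht; omega)
    have h2 := Finset.card_le_card h1
    rw [Finset.card_image_of_injective _ Nat.cast_injective, Finset.card_range] at h2
    have h3 := (Multiset.toFinset_card_le h.roots).trans (Polynomial.card_roots' h)
    omega
  have hle : d ≤ degreeOf 1 (shr t f) := by
    refine le_trans ?_ (natDegree_sub (shr t f))
    have hc : (aeval ![(0 : Polynomial ℂ), Polynomial.X]).comp (shr t) =
        (aeval ![Polynomial.C (t : ℂ) * Polynomial.X, Polynomial.X] : BP ℂ →ₐ[ℂ] Polynomial ℂ) := by
      apply MvPolynomial.algHom_ext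
      intro i
      rcases fin2_cases i with rfl | rfl
      · simp [shr_X0]
      · simp [shr_X1]
    have hc' := DFunLike.congr_fun hc f
    rw [AlgHom.comp_apply] at hc'
    rw [hc']
    apply Polynomial.le_natDegree_of_ne_zero
    rw [aeval_def, eval₂_eq', Polynomial.finsetSum_coeff]
    have h1 : ∀ m ∈ f.support, Polynomial.coeff ((algebraMap ℂ (Polynomial ℂ)) (coeff m f) *
        ∏ i, (![Polynomial.C (t : ℂ) * Polynomial.X, Polynomial.X] : Fin 2 → Polynomial ℂ) i ^ m i) d =
        if m 0 + m 1 = d then coeff m f * (t : ℂ) ^ m 0 else 0 := by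
      intro m hm
      rw [Fin.prod_univ_two]
      have e : (algebraMap ℂ (Polynomial ℂ)) (coeff m f) *
        ((Polynomial.C (t : ℂ) * Polynomial.X) ^ m 0 * Polynomial.X ^ m 1) =
        Polynomial.C (coeff m f * (t : ℂ) ^ m 0) * Polynomial.X ^ (m 0 + m 1) := by
        rw [Polynomial.algebraMap_eq, mul_pow, pow_add, Polynomial.C_mul, Polynomial.C_pow]
        ring
      change Polynomial.coeff ((algebraMap ℂ (Polynomial ℂ)) (coeff m f) *
        ((Polynomial.C (t : ℂ) * Polynomial.X) ^ m 0 * Polynomial.X ^ m 1)) d = _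
      rw [e, Polynomial.coeff_C_mul_X_pow]
      simp only [eq_comm]
    rw [Finset.sum_congr rfl h1, ← Finset.sum_filter]
    rw [hh, Polynomial.eval_finsetSum] at ht
    simpa [Polynomial.eval_monomial] using ht
  have hle2 := degreeOf_le_totalDegree (shr t f) 1
  have hle3 := shr_tdeg t f
  exact ⟨t, htd, shr_irr t f hf, by omega, by omega⟩


theorem sigma_sum (A B : ℕ) (hB : 1 ≤ B) :
    2 * (∑ i ∈ Finset.range (A*B), (i / B + i % B)) + 2 * (A * B) = A * B * A + A * B * B := by
  induction A with
  | zero => simp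
  | succ A ih =>
    have h1 : ∀ i ∈ Finset.range B, ((A * B + i) / B + (A * B + i) % B) = A + i := by
      intro i hi
      have hi' := Finset.mem_range.mp hi
      have e1 : (A * B + i) / B = A := by
        rw [mul_comm, Nat.mul_add_div (by omega), Nat.div_eq_of_lt hi']; simp
      have e2 : (A * B + i) % B = i := by
        rw [mul_comm, Nat.mul_add_mod, Nat.mod_eq_of_lt hi']
      rw [e1, e2]
    rw [show (A + 1) * B = A * B + B by ring, Finset.sum_range_add, Finset.sum_congr rfl h1,
      Finset.sum_add_distrib (s := Finset.range B) (f := fun _ => A) (g := fun i => i),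
      Finset.sum_const, Finset.card_range, smul_eq_mul]
    have h2 := Finset.sum_range_id_mul_two B
    obtain ⟨b, rfl⟩ : ∃ b, B = b + 1 := ⟨B - 1, by omega⟩
    simp only [Nat.add_sub_cancel] at h2
    nlinarith [ih, h2]

theorem prime_cond (A B N x p : ℕ) (hA : 2 ≤ A) (hB : 1 ≤ B) (hx : 2 ≤ x) (hN1 : 1 ≤ N)
    (hNx : N ≤ x ^ B) (hNA : N ≤ 2 ^ A) (hp : 8 * x < p) :
    (A*B).factorial * N ^ (∑ i ∈ Finset.range (A*B), (i / B + i % B))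
      < p ^ ((A*B) * (A*B - 1) / 2) := by
  have hs := sigma_sum A B hB
  set σ := ∑ i ∈ Finset.range (A*B), (i / B + i % B) with hσ
  obtain ⟨a, rfl⟩ : ∃ a, A = a + 1 := ⟨A - 1, by omega⟩
  obtain ⟨b, rfl⟩ : ∃ b, B = b + 1 := ⟨B - 1, by omega⟩
  set D := (a + 1) * (b + 1) with hD
  have hD2 : 2 ≤ D := by nlinarith
  have h2σ : σ * 2 = (a + b) * D := by nlinarith
  have hev : D * (D - 1) / 2 * 2 = D * (D - 1) :=
    Nat.div_mul_cancel (Nat.even_mul_pred_self D).two_dvd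
  rw [← Nat.pow_lt_pow_iff_left (n := 2) (by norm_num), mul_pow, ← pow_mul, ← pow_mul, hev, h2σ]
  have hfac : D.factorial ^ 2 ≤ (4 ^ (D - 1)) ^ D := by
    have h1 : D.factorial ≤ D ^ D := Nat.factorial_le_pow D
    have h2 : D ≤ 2 ^ (D - 1) := by
      have := Nat.lt_two_pow_self (n := D - 1); omega
    calc D.factorial ^ 2 ≤ (D ^ D) ^ 2 := Nat.pow_le_pow_left h1 2
      _ = (D ^ 2) ^ D := by rw [← pow_mul, ← pow_mul, mul_comm]
      _ ≤ ((2 ^ (D - 1)) ^ 2) ^ D := by gcongr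
      _ = (4 ^ (D - 1)) ^ D := by
        congr 1; rw [← pow_mul, mul_comm, pow_mul]; norm_num
  have hNN : N ^ (a + b) ≤ (2 * x) ^ (D - 1) := by
    have e1 : N ^ a ≤ x ^ (D - 1) := by
      calc N ^ a ≤ (x ^ (b + 1)) ^ a := by gcongr
        _ = x ^ ((b + 1) * a) := by rw [pow_mul]
        _ ≤ x ^ (D - 1) := Nat.pow_le_pow_right (by omega) (by
          have : D = (b + 1) * a + (b + 1) := by rw [hD]; ring
          omega)
    have e2 : N ^ b ≤ 2 ^ (D - 1) := by
      calc N ^ b ≤ (2 ^ (a + 1)) ^ b := by gcongr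
        _ = 2 ^ ((a + 1) * b) := by rw [pow_mul]
        _ ≤ 2 ^ (D - 1) := Nat.pow_le_pow_right (by omega) (by
          have : D = (a + 1) * b + (a + 1) := by rw [hD]; ring
          omega)
    calc N ^ (a + b) = N ^ b * N ^ a := by rw [pow_add, mul_comm]
      _ ≤ 2 ^ (D - 1) * x ^ (D - 1) := Nat.mul_le_mul e2 e1
      _ = _ := by rw [mul_pow]
  calc D.factorial ^ 2 * N ^ ((a + b) * D) ≤ (4 ^ (D - 1)) ^ D * ((2 * x) ^ (D - 1)) ^ D := by
        rw [pow_mul]; gcongr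
    _ = (8 * x) ^ (D * (D - 1)) := by
        rw [← mul_pow, ← mul_pow, mul_comm D, pow_mul]; ring
    _ < p ^ (D * (D - 1)) := Nat.pow_lt_pow_left hp (by
        have : 0 < D * (D - 1) := Nat.mul_pos (by omega) (by omega)
        omega)

theorem pi_lower (n k : ℕ) (hn : 6 ≤ n) (hk : n ≤ 2 ^ k) :
    n ≤ 2 * k * Nat.primeCounting n := by
  have h := Chebyshev.pi_ge n
  have hn' : (6:ℝ) ≤ n := by exact_mod_cast hn
  have hlogn : 0 < Real.log n := Real.log_pos (by linarith)
  have hl2 : 0 < Real.log 2 := Real.log_pos (by norm_num)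
  rw [div_le_iff₀ hlogn] at h
  have h1 : Real.log n ≤ k * Real.log 2 := by
    rw [← Real.log_pow]
    exact Real.log_le_log (by linarith) (by exact_mod_cast hk)
  have h2 : (n + 1) ^ 2 ≤ 2 ^ n := by
    clear * - hn
    induction n, hn using Nat.le_induction with
    | base => norm_num
    | succ m hm ih => rw [pow_succ 2]; nlinarith
  have h3 : 2 * Real.log (n + 1) ≤ n * Real.log 2 := by
    have := Real.log_le_log (x := ((n:ℝ) + 1) ^ 2) (y := 2 ^ n) (by positivity) (by exact_mod_cast h2)
    rw [Real.log_pow, Real.log_pow] at this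
    exact_mod_cast this
  have h4 : (n : ℝ) * Real.log 2 ≤ (2 * k * Nat.primeCounting n) * Real.log 2 := by
    have : (Nat.primeCounting n : ℝ) * Real.log n ≤ Nat.primeCounting n * (k * Real.log 2) := by gcongr
    nlinarith
  have := le_of_mul_le_mul_right h4 hl2
  exact_mod_cast this

theorem primes_exist (A d x : ℕ) (hA : 2 ≤ A) (hdA : d ≤ 2 ^ A) (hx2 : 2 ≤ x) (hx : x ≤ 3 * 2 ^ A) :
    ∃ Ps : Finset ℕ, (∀ p ∈ Ps, p.Prime ∧ p ≤ 66 * A * (8 * x + 400 * d * A ^ 5) ∧ 8 * x < p) ∧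
      2 * (200 * d * A ^ 5) ≤ Ps.card := by
  set M := 8 * x + 400 * d * A ^ 5 with hM
  have hM16 : 16 ≤ M := by omega
  have hA2 : A ≤ 2 ^ A := Nat.lt_two_pow_self.le
  have h4A : 4 ≤ 2 ^ A := by
    calc 4 = 2 ^ 2 := by norm_num
      _ ≤ 2 ^ A := Nat.pow_le_pow_right (by norm_num) hA
  have hM2 : M ≤ 2 ^ (11 * A) := by
    have e : 2 ^ (11 * A) = (2 ^ A) ^ 11 := by rw [← pow_mul, mul_comm]
    rw [e]
    generalize 2 ^ A = u at *
    have e1 : 400 * d * A ^ 5 ≤ 400 * u * u ^ 5 := by gcongr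
    have e2 : 4 ^ 5 * u ^ 6 ≤ u ^ 5 * u ^ 6 := by gcongr
    have e3 : u ^ 1 ≤ u ^ 6 := Nat.pow_le_pow_right (by omega) (by norm_num)
    nlinarith
  set n := 66 * A * M with hn
  have hn6 : 6 ≤ n := by nlinarith
  have hnk : n ≤ 2 ^ (3 * (11 * A)) := by
    have e : 66 * A ≤ 2 ^ (2 * (11 * A)) := by
      have q1 : 2 * (11 * A) < 2 ^ (2 * (11*A) - 2 + 2) := by
        rw [Nat.sub_add_cancel (by omega)]; exact Nat.lt_two_pow_self
      have : ∀ j : ℕ, 2 ≤ j → 6 * j ≤ 4 ^ j := by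
        intro j hj
        induction j, hj using Nat.le_induction with
        | base => norm_num
        | succ m hm ih => rw [pow_succ]; omega
      have := this (11 * A) (by omega)
      rw [pow_mul]; norm_num; omega
    calc n = 66 * A * M := rfl
      _ ≤ 2 ^ (2 * (11 * A)) * 2 ^ (11 * A) := Nat.mul_le_mul e hM2
      _ = _ := by rw [← pow_add]; congr 1; ring
  have hpi := pi_lower n _ hn6 hnk
  have hpiM : M ≤ Nat.primeCounting n := by
    have : 66 * A * M ≤ 66 * A * Nat.primeCounting n := by
      calc 66 * A * M = n := rfl
        _ ≤ _ := hpi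
        _ = _ := by ring
    exact Nat.le_of_mul_le_mul_left this (by omega)
  refine ⟨(Nat.primesLE n).filter (fun p => 8 * x < p), ?_, ?_⟩
  · intro p hp
    rw [Finset.mem_filter, Nat.mem_primesLE] at hp
    exact ⟨hp.1.2, hp.1.1, hp.2⟩
  · have h1 := Finset.card_filter_add_card_filter_not (s := Nat.primesLE n) (fun p => 8 * x < p)
    rw [Nat.primesLE_card_eq_primeCounting] at h1
    have h2 : ((Nat.primesLE n).filter (fun p => ¬ 8 * x < p)).card ≤ 8 * x := by
      calc _ ≤ (Finset.Icc 1 (8 * x)).card := by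
            apply Finset.card_le_card
            intro p hp
            rw [Finset.mem_filter, Nat.mem_primesLE] at hp
            rw [Finset.mem_Icc]
            exact ⟨hp.1.2.one_le, by omega⟩
        _ = 8 * x := by simp
    have : 2 * (200 * d * A ^ 5) = 400 * d * A ^ 5 := by ring
    omega


theorem main_large (P : BP ℂ) (hP : Irreducible P) (d : ℕ) (hPd : P.totalDegree = d) (hd : 1 ≤ d)
    (H : ℝ) (hH : 2 ≤ H) (hdH : (d : ℝ) ≤ H) (T : Finset (ℤ × ℤ))
    (hT : ∀ p ∈ T, eval ![(p.1 : ℂ), (p.2 : ℂ)] P = 0 ∧ (|p.1| : ℝ) ≤ H ∧ (|p.2| : ℝ) ≤ H) :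
    (T.card : ℝ) ≤ 450000 * 6 ^ 8 * (d : ℝ) ^ 2 * H ^ ((1 : ℝ) / (d : ℝ)) * Real.log H ^ 8 := by
  obtain ⟨t, ht, hirr, htd, hd1⟩ := shear_exists P hP d hPd hd
  have hd' : (1:ℝ) ≤ d := by exact_mod_cast hd
  set y : ℝ := H ^ ((1 : ℝ) / (d : ℝ)) with hy
  have hy1 : 1 ≤ y := Real.one_le_rpow (by linarith) (by positivity)
  have hyd : y ^ d = H := by
    rw [hy, one_div]; exact Real.rpow_inv_natCast_pow (by linarith) (by omega)
  have hyH : y ≤ H := by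
    rw [← hyd]; exact le_self_pow₀ hy1 (by omega)
  set N := ⌊((d:ℝ) + 1) * H⌋₊ with hN
  have hNle : (N : ℝ) ≤ (d + 1) * H := Nat.floor_le (by positivity)
  have hNlt : ((d:ℝ) + 1) * H < N + 1 := Nat.lt_floor_add_one _
  have hHN : H ≤ N := by nlinarith
  have hN4 : 4 ≤ N := Nat.le_floor (by push_cast; nlinarith)
  set A := Nat.clog 2 N with hA
  have hNA : N ≤ 2 ^ A := Nat.le_pow_clog (by norm_num) N
  have hA2 : 2 ≤ A := by
    by_contra hc
    have : 2 ^ A ≤ 2 ^ 1 := Nat.pow_le_pow_right (by norm_num) (by omega)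
    omega
  have hAN : 2 ^ (A - 1) < N := Nat.pow_pred_clog_lt_self (by norm_num) (by omega)
  have hdA : d ≤ 2 ^ A := by
    have : d ≤ N := by exact_mod_cast hdH.trans hHN
    omega
  set B := min d A with hB
  have hB1 : 1 ≤ B := by rw [hB]; exact le_min hd (by omega)
  have hBA : B ≤ A := min_le_right _ _
  have hBd : B ≤ d := min_le_left _ _
  set x := ⌈2 * y⌉₊ with hx
  have hxge : 2 * y ≤ x := Nat.le_ceil _
  have hxlt : (x:ℝ) < 2 * y + 1 := Nat.ceil_lt_add_one (by linarith)
  have hx2 : 2 ≤ x := by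
    have : (2:ℝ) ≤ x := by linarith
    exact_mod_cast this
  have hx3 : (x:ℝ) ≤ 3 * y := by linarith
  have hxA : x ≤ 3 * 2 ^ A := by
    have h1 : (x:ℝ) ≤ (3 * N : ℕ) := by push_cast; linarith
    have h2 : x ≤ 3 * N := by exact_mod_cast h1
    omega
  have hNxd : N ≤ x ^ d := by
    have h1 : (d:ℝ) + 1 ≤ 2 ^ d := by exact_mod_cast Nat.lt_two_pow_self (n := d)
    have : (N:ℝ) ≤ (x:ℝ) ^ d := by
      calc (N:ℝ) ≤ (d + 1) * H := hNle
        _ ≤ 2 ^ d * y ^ d := by rw [hyd]; gcongr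
        _ = (2 * y) ^ d := by rw [mul_pow]
        _ ≤ (x:ℝ) ^ d := by gcongr
    exact_mod_cast this
  have hNxB : N ≤ x ^ B := by
    rcases min_choice d A with h | h
    · rw [hB, h]; exact hNxd
    · rw [hB, h]; exact hNA.trans (Nat.pow_le_pow_left hx2 A)
  obtain ⟨Ps, hPs, hcard⟩ := primes_exist A d x hA2 hdA hx2 hxA
  set φ : ℤ × ℤ → ℤ × ℤ := fun p => (p.1 - t * p.2, p.2) with hφ
  have hinj : Function.Injective φ := by
    rintro ⟨a, b⟩ ⟨a', b'⟩ h
    simp only [hφ, Prod.mk.injEq] at h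
    obtain ⟨h1, h2⟩ := h
    subst h2
    simp only [Prod.mk.injEq, and_true]; linarith
  have hc := core (shr t P) hirr d htd hd hd1 A B N (66 * A * (8 * x + 400 * d * A ^ 5))
    (by omega) hB1 hBA hBd hdA hNA (by omega) Ps
    (fun p hp => ⟨(hPs p hp).1, (hPs p hp).2.1,
      prime_cond A B N x p hA2 hB1 hx2 (by omega) hNxB hNA (hPs p hp).2.2⟩) hcard (T.image φ) (by
    intro z hz
    obtain ⟨p, hp, rfl⟩ := Finset.mem_image.mp hz
    obtain ⟨h0, h1, h2⟩ := hT p hp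
    have ht' : (t:ℝ) ≤ d := by exact_mod_cast ht
    have key : ∀ a : ℤ, |(a:ℝ)| ≤ (d + 1) * H → |a| ≤ (N:ℤ) := by
      intro a ha
      have : ((a.natAbs : ℕ) : ℝ) ≤ (d + 1) * H := by
        rw [Nat.cast_natAbs]; push_cast; exact ha
      have h5 : a.natAbs ≤ N := Nat.le_floor this
      rw [Int.abs_eq_natAbs]
      exact_mod_cast h5
    refine ⟨?_, key _ ?_, key _ ?_⟩
    · have := shr_eval (t:ℂ) P (p.1:ℂ) (p.2:ℂ)
      simp only [hφ]
      push_cast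
      rw [this, h0]
    · simp only [hφ]
      push_cast
      calc |(p.1:ℝ) - t * p.2| ≤ |(p.1:ℝ)| + |(t:ℝ) * p.2| := abs_sub _ _
        _ = |(p.1:ℝ)| + t * |(p.2:ℝ)| := by rw [abs_mul, Nat.abs_cast]
        _ ≤ H + d * H := by gcongr
        _ = _ := by ring
    · simp only [hφ]
      nlinarith)
  rw [Finset.card_image_of_injective _ hinj] at hc
  have hnat : T.card ≤ d ^ 2 * A ^ 8 * (422425 + 8448 * x) := by
    have hD : A * B ≤ A ^ 2 := by rw [sq]; gcongr
    have hA1 : 1 ≤ A := by omega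
    have p1 : 1 ≤ A ^ 8 := Nat.one_le_pow _ _ (by omega)
    have p4 : A ^ 4 ≤ A ^ 8 := Nat.pow_le_pow_right hA1 (by norm_num)
    have p3 : A ^ 3 ≤ A ^ 8 := Nat.pow_le_pow_right hA1 (by norm_num)
    have pd : d ≤ d ^ 2 := Nat.le_self_pow (by norm_num) d
    have e1 : d * ((A*B) * ((A*B) * (8*d+1)) + 8*d) ≤ d * (A^2 * (A^2 * (9 * d)) + 8 * d) := by
      gcongr; omega
    have e2 : 2 * ((A*B) * (8*d*(66 * A * (8 * x + 400 * d * A ^ 5)))) ≤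
        2 * (A^2 * (8*d*(66 * A * (8 * x + 400 * d * A ^ 5)))) := by gcongr
    have q1 : d ^ 2 * 1 ≤ d ^ 2 * A ^ 8 := by gcongr
    have q2 : d ^ 2 * A ^ 4 ≤ d ^ 2 * A ^ 8 := by gcongr
    have q3 : d * A ^ 3 * x ≤ d ^ 2 * A ^ 8 * x := by gcongr
    calc T.card ≤ _ := hc
      _ ≤ 8 * d ^ 2 + d * (A^2 * (A^2 * (9 * d)) + 8 * d) +
        2 * (A^2 * (8*d*(66 * A * (8 * x + 400 * d * A ^ 5)))) := by
          exact Nat.add_le_add (Nat.add_le_add le_rfl e1) e2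
      _ = 16 * (d ^ 2 * 1) + 9 * (d ^ 2 * A ^ 4) + 8448 * (d * A ^ 3 * x)
          + 422400 * (d ^ 2 * A ^ 8) := by ring
      _ ≤ 16 * (d ^ 2 * A ^ 8) + 9 * (d ^ 2 * A ^ 8) + 8448 * (d ^ 2 * A ^ 8 * x)
          + 422400 * (d ^ 2 * A ^ 8) := by gcongr
      _ = _ := by ring
  have hAlog : (A:ℝ) ≤ 6 * Real.log H := by
    have h1 : (2:ℝ) ^ (A - 1) ≤ H ^ 3 := by
      have : (2:ℝ) ^ (A - 1) ≤ N := by exact_mod_cast hAN.le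
      have h3 : ((d:ℝ) + 1) * H ≤ (H + H) * H := by gcongr; linarith
      have h4 : (2:ℝ) * H ^ 2 ≤ H * H ^ 2 := by gcongr
      nlinarith
    have h2 := Real.log_le_log (by positivity) h1
    rw [Real.log_pow, Real.log_pow, Nat.cast_sub (by omega)] at h2
    push_cast at h2
    have h3 : Real.log 2 ≤ Real.log H := Real.log_le_log (by norm_num) hH
    have h4 := Real.log_two_gt_d9
    have hA0 : (0:ℝ) ≤ A := by positivity
    nlinarith
  have hlog0 : 0 ≤ Real.log H := Real.log_nonneg (by linarith)
  calc (T.card : ℝ) ≤ (d:ℝ) ^ 2 * A ^ 8 * (422425 + 8448 * x) := by exact_mod_cast hnat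
    _ ≤ (d:ℝ) ^ 2 * (6 * Real.log H) ^ 8 * (450000 * y) := by
      gcongr
      linarith
    _ = _ := by ring

theorem integral_points_on_complex_plane_curve
    : ∃ c κ : ℝ, 0 < c ∧ 0 < κ ∧
      ∀ (P : MvPolynomial (Fin 2) ℂ), Irreducible P →
      ∀ d : ℕ, d = P.totalDegree → 0 < d →
      ∀ H : ℝ, 2 ≤ H →
      ∀ S : Set (ℤ × ℤ),
        S = {p : ℤ × ℤ | MvPolynomial.eval ![(p.1 : ℂ), (p.2 : ℂ)] P = 0 ∧ (|p.1| : ℝ) ≤ H ∧ (|p.2| : ℝ) ≤ H} →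
        S.Finite ∧
        (S.ncard : ℝ) ≤ c * (d : ℝ) ^ 2 * H ^ ((1 : ℝ) / (d : ℝ)) * Real.log H ^ κ := by
  refine ⟨450000 * 6 ^ 8, 8, by norm_num, by norm_num, ?_⟩
  intro P hP d hd hd0 H hH S hS
  set m : ℕ := ⌊H⌋₊ with hm
  have hmH : (m:ℝ) ≤ H := Nat.floor_le (by linarith)
  set I : Finset (ℤ × ℤ) := Finset.Icc (-(m:ℤ)) m ×ˢ Finset.Icc (-(m:ℤ)) m with hI
  have key : ∀ a : ℤ, (|a| : ℝ) ≤ H → a ∈ Finset.Icc (-(m:ℤ)) m := by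
    intro a ha
    have h1 : ((a.natAbs : ℕ) : ℝ) ≤ H := by
      rw [Nat.cast_natAbs]; push_cast; exact ha
    have h2 := Nat.le_floor h1
    rw [Finset.mem_Icc]
    omega
  have hsub : S ⊆ ↑I := by
    intro p hp
    rw [hS] at hp
    obtain ⟨-, h1, h2⟩ := hp
    exact Finset.mem_coe.mpr (Finset.mem_product.mpr ⟨key _ h1, key _ h2⟩)
  have hfin : S.Finite := I.finite_toSet.subset hsub
  refine ⟨hfin, ?_⟩
  rw [show (8:ℝ) = ((8:ℕ):ℝ) by norm_num, Real.rpow_natCast]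
  rcases le_or_gt (d:ℝ) H with hdH | hdH
  · rw [Set.ncard_eq_toFinset_card S hfin]
    apply main_large P hP d hd.symm hd0 H hH hdH
    intro p hp
    rw [Set.Finite.mem_toFinset, hS] at hp
    exact hp
  · have h1 : S.ncard ≤ (2 * m + 1) ^ 2 := by
      calc S.ncard ≤ (I : Set (ℤ × ℤ)).ncard := Set.ncard_le_ncard hsub I.finite_toSet
        _ = I.card := Set.ncard_coe_finset I
        _ = (2 * m + 1) ^ 2 := by
          rw [hI, Finset.card_product, Int.card_Icc, sq,
            show ((m:ℤ) + 1 - -(m:ℤ)).toNat = 2 * m + 1 by omega]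
    have h2 : (S.ncard : ℝ) ≤ (2 * m + 1) ^ 2 := by exact_mod_cast h1
    have h3 : ((2:ℝ) * m + 1) ^ 2 ≤ (3 * d) ^ 2 := by gcongr; linarith
    have hy1 : 1 ≤ H ^ ((1 : ℝ) / (d : ℝ)) := Real.one_le_rpow (by linarith) (by positivity)
    have hl : (1/2:ℝ) ≤ Real.log H := by
      have h3 : Real.log 2 ≤ Real.log H := Real.log_le_log (by norm_num) hH
      have h4 := Real.log_two_gt_d9
      linarith
    calc (S.ncard : ℝ) ≤ (3 * d) ^ 2 := h2.trans h3
      _ = 9 * 2 ^ 8 * d ^ 2 * 1 * (1/2) ^ 8 := by ring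
      _ ≤ _ := by gcongr <;> norm_num
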